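/- arXiv:2302.07542 — 10 statements merged into one kernel-verified Lean document; each statement's English description precedes it below -/
import Mathlib

section
/- For every real γ ≥ 0 one has K_γ ≥ 0. -/
/-- Scaled fixation factor: `ω_γ = 2γ/(1 − e^{−2γ})` for `γ ≠ 0`, and `ω_0 = 1`. -/
noncomputable def omegaSel (γ : ℝ) : ℝ :=
  if γ = 0 then 1 else 2 * γ / (1 - Real.exp (-2 * γ))

/-- `K_γ = ω_γ ∫_0^1 (−ln y)(e^{−2γy} − e^{−2γ(1−y)}) dy`. -/
noncomputable def Ksel (γ : ℝ) : ℝ :=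
  omegaSel γ *
    ∫ y in (0:ℝ)..1, (-Real.log y) * (Real.exp (-2 * γ * y) - Real.exp (-2 * γ * (1 - y)))

/-- For every real `γ ≥ 0` one has `K_γ ≥ 0`. -/
theorem Ksel_nonneg (γ : ℝ) (hγ : 0 ≤ γ) : 0 ≤ Ksel γ := by
  have hω : 0 ≤ omegaSel γ := by
    unfold omegaSel
    split_ifs
    · norm_num
    · have : Real.exp (-2 * γ) ≤ 1 := Real.exp_le_one_iff.mpr (by linarith)
      exact div_nonneg (by linarith) (by linarith)
  refine mul_nonneg hω ?_
  have hc : Continuous (fun y : ℝ => Real.exp (-2 * γ * y) - Real.exp (-2 * γ * (1 - y))) := by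
    fun_prop
  have hlog : IntervalIntegrable (fun y : ℝ => -Real.log y) MeasureTheory.volume 0 1 :=
    intervalIntegral.intervalIntegrable_log'.neg
  have h1 : IntervalIntegrable (fun y : ℝ => (-Real.log y) *
      (Real.exp (-2 * γ * y) - Real.exp (-2 * γ * (1 - y)))) MeasureTheory.volume 0 1 :=
    hlog.mul_continuousOn hc.continuousOn
  have h2 : IntervalIntegrable (fun y : ℝ => Real.log 2 *
      (Real.exp (-2 * γ * y) - Real.exp (-2 * γ * (1 - y)))) MeasureTheory.volume 0 1 :=
    (hc.const_mul _).intervalIntegrable _ _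
  have h0 : ∫ y in (0:ℝ)..1, Real.log 2 *
      (Real.exp (-2 * γ * y) - Real.exp (-2 * γ * (1 - y))) = 0 := by
    have hs := intervalIntegral.integral_comp_sub_left (a := 0) (b := 1)
      (fun y : ℝ => Real.exp (-2 * γ * y)) 1
    simp only [sub_self, sub_zero] at hs
    rw [intervalIntegral.integral_const_mul, intervalIntegral.integral_sub, hs, sub_self, mul_zero]
    · exact Continuous.intervalIntegrable (by fun_prop) _ _
    · exact Continuous.intervalIntegrable (by fun_prop) _ _
  refine h0.symm.le.trans ?_
  refine intervalIntegral.integral_mono_on_of_le_Ioo zero_le_one h2 h1 ?_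
  intro y hy
  have hy0 : 0 < y := hy.1
  have hl : Real.log (2 * y) = Real.log 2 + Real.log y :=
    Real.log_mul (by norm_num) hy0.ne'
  rcases le_total y (1 / 2) with h | h
  · have a : Real.log (2 * y) ≤ 0 := Real.log_nonpos (by linarith) (by linarith)
    have b : Real.exp (-2 * γ * (1 - y)) ≤ Real.exp (-2 * γ * y) :=
      Real.exp_le_exp.mpr (by nlinarith)
    exact mul_le_mul_of_nonneg_right (by linarith) (by linarith)
  · have a : 0 ≤ Real.log (2 * y) := Real.log_nonneg (by linarith)
    have b : Real.exp (-2 * γ * y) ≤ Real.exp (-2 * γ * (1 - y)) :=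
      Real.exp_le_exp.mpr (by nlinarith)
    exact mul_le_mul_of_nonpos_right (by linarith) (by linarith)
end

section
/- For every real γ with 0 ≤ γ ≤ 1 one has K_γ ≤ γ. -/
theorem aux_sinh (t x : ℝ) (ht : 0 ≤ t) (ht1 : t ≤ 1) (hx : 0 ≤ x) :
    Real.sinh (t * x) ≤ t * Real.sinh x := by
  have hd : ∀ z : ℝ, HasDerivAt (fun z => t * Real.sinh z - Real.sinh (t * z))
      (t * Real.cosh z - Real.cosh (t * z) * (t * 1)) z := fun z =>
    ((Real.hasDerivAt_sinh z).const_mul t).sub (((hasDerivAt_id z).const_mul t).sinh)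
  have hm : MonotoneOn (fun z => t * Real.sinh z - Real.sinh (t * z)) (Set.Ici 0) := by
    apply monotoneOn_of_deriv_nonneg (convex_Ici 0)
    · exact fun z _ => (hd z).continuousAt.continuousWithinAt
    · exact fun z _ => (hd z).differentiableAt.differentiableWithinAt
    · intro z hz
      rw [interior_Ici] at hz
      have hz : 0 < z := hz
      rw [(hd z).deriv]
      have : Real.cosh (t * z) ≤ Real.cosh z := by
        rw [Real.cosh_le_cosh, abs_of_nonneg (by positivity), abs_of_nonneg hz.le]
        nlinarith
      nlinarith
  have := hm (Set.mem_Ici.2 le_rfl) (Set.mem_Ici.2 hx) hx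
  simp at this
  linarith

theorem aux_g (γ y : ℝ) : Real.exp (-2 * γ * y) - Real.exp (-2 * γ * (1 - y))
    = 2 * Real.exp (-γ) * Real.sinh ((1 - 2 * y) * γ) := by
  rw [Real.sinh_eq]
  have h1 : Real.exp (-2 * γ * y) = Real.exp (-γ) * Real.exp ((1 - 2 * y) * γ) := by
    rw [← Real.exp_add]; congr 1; ring
  have h2 : Real.exp (-2 * γ * (1 - y)) = Real.exp (-γ) * Real.exp (-((1 - 2 * y) * γ)) := by
    rw [← Real.exp_add]; congr 1; ring
  rw [h1, h2]; ring

theorem aux_int : ∫ y in (0:ℝ)..1, (-Real.log y) * (1 - 2 * y) = 1 / 2 := by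
  rw [intervalIntegral.integral_eq_sub_of_hasDerivAt_of_le (zero_le_one)
    (f := fun y => -(y * Real.log y) + y + y * (y * Real.log y) - y ^ 2 / 2)]
  · norm_num
  · have := Real.continuous_mul_log
    exact Continuous.continuousOn (by fun_prop)
  · intro y hy
    have h0 : y ≠ 0 := hy.1.ne'
    have h := Real.hasDerivAt_mul_log h0
    have := ((h.neg.add (hasDerivAt_id y)).add ((hasDerivAt_id y).mul h)).sub
      (((hasDerivAt_id y).pow 2).div_const 2)
    refine (this.congr_deriv ?_)
    simp
    ring
  · exact intervalIntegral.intervalIntegrable_log'.neg.mul_continuousOn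
      (Continuous.continuousOn (by fun_prop))

theorem aux_main (γ : ℝ) (h0 : 0 ≤ γ) :
    ∫ y in (0:ℝ)..1, (-Real.log y) * Real.sinh ((1 - 2 * y) * γ) ≤ Real.sinh γ / 2 := by
  have hl : IntervalIntegrable (fun y => -Real.log y) MeasureTheory.volume 0 1 :=
    intervalIntegral.intervalIntegrable_log'.neg
  have hcD : Continuous (fun y : ℝ => (1 - 2 * y) * Real.sinh γ - Real.sinh ((1 - 2 * y) * γ)) := by
    have := Real.continuous_sinh
    fun_prop
  have hcs : Continuous (fun y : ℝ => Real.sinh ((1 - 2 * y) * γ)) := by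
    have := Real.continuous_sinh
    fun_prop
  have hD0 : ∫ y in (0:ℝ)..1, ((1 - 2 * y) * Real.sinh γ - Real.sinh ((1 - 2 * y) * γ)) = 0 := by
    have := intervalIntegral.integral_comp_sub_left (a := 0) (b := 1)
      (fun y : ℝ => (1 - 2 * y) * Real.sinh γ - Real.sinh ((1 - 2 * y) * γ)) 1
    have h2 : (fun y : ℝ => (1 - 2 * (1 - y)) * Real.sinh γ - Real.sinh ((1 - 2 * (1 - y)) * γ))
      = fun y : ℝ => -((1 - 2 * y) * Real.sinh γ - Real.sinh ((1 - 2 * y) * γ)) := by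
      funext y
      rw [show (1 - 2 * (1 - y)) * γ = -((1 - 2 * y) * γ) by ring, Real.sinh_neg]
      ring
    rw [h2, intervalIntegral.integral_neg] at this
    norm_num at this
    linarith
  have key : ∫ y in (0:ℝ)..1, Real.log 2 *
        ((1 - 2 * y) * Real.sinh γ - Real.sinh ((1 - 2 * y) * γ)) ≤
      ∫ y in (0:ℝ)..1, (-Real.log y) *
        ((1 - 2 * y) * Real.sinh γ - Real.sinh ((1 - 2 * y) * γ)) := by
    apply intervalIntegral.integral_mono_on_of_le_Ioo zero_le_one
    · exact (continuous_const.mul hcD).intervalIntegrable _ _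
    · exact hl.mul_continuousOn hcD.continuousOn
    · intro y hy
      have hy0 := hy.1
      have hy1 := hy.2
      have hlog : Real.log (2 * y) = Real.log 2 + Real.log y :=
        Real.log_mul two_ne_zero hy0.ne'
      rcases le_total (2 * y) 1 with h | h
      · have a := aux_sinh (1 - 2 * y) γ (by linarith) (by linarith) h0
        have b := Real.log_nonpos (by linarith) h
        nlinarith
      · have a := aux_sinh (2 * y - 1) γ (by linarith) (by linarith) h0
        rw [show (2 * y - 1) * γ = -((1 - 2 * y) * γ) by ring, Real.sinh_neg] at a
        have b := Real.log_nonneg h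
        nlinarith
  rw [intervalIntegral.integral_const_mul, hD0, mul_zero] at key
  have hsplit : ∫ y in (0:ℝ)..1, (-Real.log y) *
        ((1 - 2 * y) * Real.sinh γ - Real.sinh ((1 - 2 * y) * γ)) =
      (∫ y in (0:ℝ)..1, (-Real.log y) * (1 - 2 * y)) * Real.sinh γ -
      ∫ y in (0:ℝ)..1, (-Real.log y) * Real.sinh ((1 - 2 * y) * γ) := by
    rw [← intervalIntegral.integral_mul_const, ← intervalIntegral.integral_sub]
    · congr 1; funext y; ring
    · exact (hl.mul_continuousOn (Continuous.continuousOn (by fun_prop))).mul_const _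
    · exact hl.mul_continuousOn hcs.continuousOn
  rw [hsplit, aux_int] at key
  linarith

/-- For `0 ≤ γ ≤ 1` one has `K_γ ≤ γ`. -/
theorem Ksel_le_self (γ : ℝ) (h0 : 0 ≤ γ) (h1 : γ ≤ 1) : Ksel γ ≤ γ := by
  unfold Ksel omegaSel
  rcases h0.eq_or_lt with rfl | hpos
  · simp
  rw [if_neg hpos.ne']
  have hm := aux_main γ h0
  have e1 := aux_g γ 0
  simp only [mul_zero, Real.exp_zero, sub_zero, mul_one, one_mul] at e1
  simp_rw [aux_g]
  rw [e1]
  have hs : 0 < Real.sinh γ := Real.sinh_pos_iff.2 hpos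
  have he := Real.exp_pos (-γ)
  have : ∫ y in (0:ℝ)..1, (-Real.log y) * (2 * Real.exp (-γ) * Real.sinh ((1 - 2 * y) * γ))
      = 2 * Real.exp (-γ) * ∫ y in (0:ℝ)..1, (-Real.log y) * Real.sinh ((1 - 2 * y) * γ) := by
    rw [← intervalIntegral.integral_const_mul]
    congr 1; funext y; ring
  rw [this]
  generalize (∫ y in (0:ℝ)..1, (-Real.log y) * Real.sinh ((1 - 2 * y) * γ)) = I at *
  rw [div_mul_eq_mul_div, div_le_iff₀ (by positivity)]
  have : 0 ≤ γ * Real.exp (-γ) := by positivity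
  nlinarith
end

section
/- For every real γ ≥ 1 one has K_γ ≤ γ_e + ln(2γ), where γ_e is the Euler–Mascheroni constant. -/
open MeasureTheory Set Filter Topology in
lemma aux_log_exp_integral :
    ∫ t in Ioi (0:ℝ), Real.log t * Real.exp (-t) = -Real.eulerMascheroniConstant := by
  have h1 := Complex.hasDerivAt_GammaIntegral (s := 1) (by simp)
  have h2 : HasDerivAt Complex.GammaIntegral (-(Real.eulerMascheroniConstant : ℂ)) 1 := by
    refine Complex.hasDerivAt_Gamma_one.congr_of_eventuallyEq ?_
    have : IsOpen {s : ℂ | 0 < s.re} := isOpen_lt continuous_const Complex.continuous_re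
    filter_upwards [this.mem_nhds (by simp : (1:ℂ) ∈ {s : ℂ | 0 < s.re})] with s hs
    exact (Complex.Gamma_eq_integral hs).symm
  have h3 := h1.unique h2
  have h4 : (∫ t : ℝ in Ioi 0, (t:ℂ) ^ ((1:ℂ) - 1) * ((Real.log t : ℂ) * (Real.exp (-t) : ℂ)))
      = ((∫ t in Ioi (0:ℝ), Real.log t * Real.exp (-t) : ℝ) : ℂ) := by
    rw [← integral_complex_ofReal]
    simp
  rw [h4] at h3
  exact_mod_cast h3

open MeasureTheory Set Filter Topology in
lemma aux_log_exp_integrable :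
    IntegrableOn (fun t => Real.log t * Real.exp (-t)) (Ioi (0:ℝ)) := by
  by_contra hc
  have h := aux_log_exp_integral
  rw [integral_undef hc] at h
  have := Real.one_half_lt_eulerMascheroniConstant
  linarith

open MeasureTheory Set Filter Topology in
lemma aux_tail_id (a : ℝ) (ha : 0 < a) :
    IntegrableOn (fun t => t * Real.exp (-t)) (Ioi a) ∧
    ∫ t in Ioi a, t * Real.exp (-t) = (a + 1) * Real.exp (-a) := by
  have hi : IntegrableOn (fun t => t * Real.exp (-t)) (Ioi a) := by
    refine ((Real.GammaIntegral_convergent (s := 2) (by norm_num)).mono_set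
      (Ioi_subset_Ioi ha.le)).congr_fun (fun x hx => ?_) measurableSet_Ioi
    norm_num
    ring
  refine ⟨hi, ?_⟩
  have hd : ∀ x ∈ Ici a, HasDerivAt (fun t : ℝ => -(t + 1) * Real.exp (-t)) (x * Real.exp (-x)) x := by
    intro x _
    have := (((hasDerivAt_id x).add_const (1:ℝ)).neg).mul ((hasDerivAt_id x).neg.exp)
    refine this.congr_deriv ?_
    simp
    ring
  have ht : Tendsto (fun t : ℝ => -(t + 1) * Real.exp (-t)) atTop (𝓝 0) := by
    have h1 := Real.tendsto_pow_mul_exp_neg_atTop_nhds_zero 1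
    have h0 := Real.tendsto_pow_mul_exp_neg_atTop_nhds_zero 0
    have := (h1.add h0).neg
    simp only [add_zero, neg_zero] at this
    refine this.congr (fun x => ?_)
    simp
    ring
  rw [integral_Ioi_of_hasDerivAt_of_tendsto' hd hi ht]
  ring

open MeasureTheory Set Filter Topology in
lemma aux_tail (a : ℝ) (ha : 0 < a) :
    ∫ t in Ioi a, Real.log t * Real.exp (-t) ≤ (Real.log a + 1 / a) * Real.exp (-a) := by
  obtain ⟨hi, he⟩ := aux_tail_id a ha
  have hx := integrableOn_exp_neg_Ioi a
  have hL : IntegrableOn (fun t => Real.log t * Real.exp (-t)) (Ioi a) :=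
    aux_log_exp_integrable.mono_set (Ioi_subset_Ioi ha.le)
  calc ∫ t in Ioi a, Real.log t * Real.exp (-t)
      ≤ ∫ t in Ioi a, ((Real.log a - 1) * Real.exp (-t) + 1 / a * (t * Real.exp (-t))) := by
        refine setIntegral_mono_on hL ((hx.const_mul _).add (hi.const_mul _)) measurableSet_Ioi ?_
        intro t ht
        have ht0 : 0 < t := ha.trans ht
        have h1 := Real.log_le_sub_one_of_pos (div_pos ht0 ha)
        rw [Real.log_div ht0.ne' ha.ne'] at h1
        have h2 : Real.log t ≤ Real.log a - 1 + 1 / a * t := by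
          have : t / a = 1 / a * t := by ring
          linarith
        have := mul_le_mul_of_nonneg_right h2 (Real.exp_pos (-t)).le
        linarith
    _ = _ := by
        rw [integral_add (hx.const_mul _) (hi.const_mul _), integral_const_mul, integral_const_mul,
          he, integral_exp_neg_Ioi]
        field_simp
        ring

open MeasureTheory Set Filter Topology in
lemma aux_I1 (a : ℝ) (ha : 0 < a) :
    a * (∫ y in (0:ℝ)..1, (-Real.log y) * Real.exp (-a * y)) ≤
      Real.log a + Real.eulerMascheroniConstant + Real.exp (-a) / a := by
  have hL := aux_log_exp_integrable
  have e1 : (∫ y in (0:ℝ)..1, (-Real.log y) * Real.exp (-a * y)) =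
      ∫ y in (0:ℝ)..1, (fun t => Real.log a * Real.exp (-t) - Real.log t * Real.exp (-t)) (a * y) := by
    refine intervalIntegral.integral_congr_ae (Eventually.of_forall ?_)
    intro y hy
    rw [uIoc_of_le zero_le_one] at hy
    simp only [Real.log_mul ha.ne' hy.1.ne']
    ring_nf
  rw [e1, intervalIntegral.integral_comp_mul_left
    (fun t => Real.log a * Real.exp (-t) - Real.log t * Real.exp (-t)) ha.ne']
  have hx : IntervalIntegrable (fun t : ℝ => Real.exp (-t)) volume 0 a :=
    Continuous.intervalIntegrable (by fun_prop) _ _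
  have hl : IntervalIntegrable (fun t : ℝ => Real.log t * Real.exp (-t)) volume 0 a :=
    (intervalIntegrable_iff_integrableOn_Ioc_of_le ha.le).2 (hL.mono_set Ioc_subset_Ioi_self)
  simp only [mul_zero, mul_one, smul_eq_mul]
  rw [mul_inv_cancel_left₀ ha.ne', intervalIntegral.integral_sub (hx.const_mul _) hl,
    intervalIntegral.integral_const_mul]
  have e2 := intervalIntegral.integral_interval_add_Ioi hL (hL.mono_set (Ioi_subset_Ioi ha.le))
  have e3 := intervalIntegral.integral_interval_add_Ioi (integrableOn_exp_neg_Ioi 0) (integrableOn_exp_neg_Ioi a)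
  rw [integral_exp_neg_Ioi, integral_exp_neg_Ioi, neg_zero, Real.exp_zero] at e3
  rw [aux_log_exp_integral] at e2
  have e4 := aux_tail a ha
  have e5 : (∫ x in (0:ℝ)..a, Real.exp (-x)) = 1 - Real.exp (-a) := by linarith
  rw [e5]
  have : (Real.log a + 1 / a) * Real.exp (-a) = Real.log a * Real.exp (-a) + Real.exp (-a) / a := by
    ring
  linarith

open MeasureTheory Set Filter Topology in
lemma aux_I2 (a : ℝ) (ha : 0 < a) :
    1 - (1 + a) * Real.exp (-a) ≤
    a * (a * ∫ y in (0:ℝ)..1, (-Real.log y) * Real.exp (-a * (1 - y))) := by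
  have hl : IntervalIntegrable (fun y : ℝ => (-Real.log y) * Real.exp (-a * (1 - y))) volume 0 1 :=
    intervalIntegral.intervalIntegrable_log'.neg.mul_continuousOn (by fun_prop)
  have h1 : (∫ y in (0:ℝ)..1, (1 - y) * Real.exp (-a * (1 - y))) ≤
      ∫ y in (0:ℝ)..1, (-Real.log y) * Real.exp (-a * (1 - y)) := by
    refine intervalIntegral.integral_mono_on_of_le_Ioo zero_le_one
      (Continuous.intervalIntegrable (by fun_prop) _ _) hl ?_
    intro y hy
    have := Real.log_le_sub_one_of_pos hy.1
    exact mul_le_mul_of_nonneg_right (by linarith) (Real.exp_pos _).le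
  have hd : ∀ x ∈ uIcc (0:ℝ) 1, HasDerivAt
      (fun y : ℝ => ((1 - y) + 1 / a) * Real.exp (-a * (1 - y)))
      (a * ((1 - x) * Real.exp (-a * (1 - x)))) x := by
    intro x _
    have h0 : HasDerivAt (fun y : ℝ => 1 - y) (-1) x := (hasDerivAt_id x).const_sub 1
    refine ((h0.add_const (1 / a)).mul ((h0.const_mul (-a)).exp)).congr_deriv ?_
    field_simp
    ring
  have h2 := intervalIntegral.integral_eq_sub_of_hasDerivAt hd
    (Continuous.intervalIntegrable (by fun_prop) _ _)
  rw [intervalIntegral.integral_const_mul] at h2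
  simp only [sub_self, mul_zero, Real.exp_zero, sub_zero, mul_one, zero_add] at h2
  have h3 := mul_le_mul_of_nonneg_left (mul_le_mul_of_nonneg_left h1 ha.le) ha.le
  rw [h2] at h3
  have h4 : a * (1 / a - (1 + 1 / a) * Real.exp (-a)) = 1 - (1 + a) * Real.exp (-a) := by
    field_simp
    ring
  rw [h4] at h3
  exact h3

/-- For `γ ≥ 1` one has `K_γ ≤ γ_e + ln(2γ)`, with `γ_e` the Euler–Mascheroni constant. -/
theorem Ksel_le_eulerMascheroni_add_log (γ : ℝ) (h : 1 ≤ γ) :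
    Ksel γ ≤ Real.eulerMascheroniConstant + Real.log (2 * γ) := by
  have ha : (0:ℝ) < 2 * γ := by linarith
  have hK : Ksel γ = 2 * γ * ((∫ y in (0:ℝ)..1, (-Real.log y) * Real.exp (-(2 * γ) * y)) -
      ∫ y in (0:ℝ)..1, (-Real.log y) * Real.exp (-(2 * γ) * (1 - y))) /
      (1 - Real.exp (-(2 * γ))) := by
    have i1 : IntervalIntegrable (fun y : ℝ => (-Real.log y) * Real.exp (-(2 * γ) * y))
        MeasureTheory.volume 0 1 :=
      intervalIntegral.intervalIntegrable_log'.neg.mul_continuousOn (by fun_prop)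
    have i2 : IntervalIntegrable (fun y : ℝ => (-Real.log y) * Real.exp (-(2 * γ) * (1 - y)))
        MeasureTheory.volume 0 1 :=
      intervalIntegral.intervalIntegrable_log'.neg.mul_continuousOn (by fun_prop)
    rw [← intervalIntegral.integral_sub i1 i2]
    unfold Ksel omegaSel
    rw [if_neg (by linarith)]
    simp only [mul_sub, neg_mul]
    ring
  have h1 := aux_I1 (2 * γ) ha
  have h2 := aux_I2 (2 * γ) ha
  have hh : (2:ℝ) ≤ 2 * γ := by linarith
  rw [hK]
  clear hK
  generalize 2 * γ = a at *
  generalize (∫ y in (0:ℝ)..1, (-Real.log y) * Real.exp (-a * y)) = I at *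
  generalize (∫ y in (0:ℝ)..1, (-Real.log y) * Real.exp (-a * (1 - y))) = J at *
  have hE : Real.exp (-a) < 1 := by
    rw [Real.exp_lt_one_iff]
    linarith
  rw [div_le_iff₀ (by linarith)]
  have hL : Real.eulerMascheroniConstant + Real.log a ≤ a / 2 + 37 / 100 := by
    have k1 := Real.eulerMascheroniConstant_lt_two_thirds
    have k2 := Real.log_two_lt_d9
    have k3 := Real.log_le_sub_one_of_pos (show 0 < a / 2 by linarith)
    rw [Real.log_div ha.ne' (by norm_num)] at k3
    linarith
  have hexp := Real.sum_le_exp_of_nonneg ha.le 5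
  simp only [Finset.sum_range_succ, Finset.sum_range_zero, Nat.factorial] at hexp
  norm_num at hexp
  have key : 2 + a + a * (Real.eulerMascheroniConstant + Real.log a) ≤ Real.exp a := by
    have k1 := mul_le_mul_of_nonneg_left hL ha.le
    have k2 : 4 ≤ a ^ 2 := by nlinarith
    have k3 : 4 * a ≤ a ^ 3 := by nlinarith
    have k4 : 16 ≤ a ^ 4 := by nlinarith
    nlinarith
  have hEE : Real.exp a * Real.exp (-a) = 1 := by
    rw [← Real.exp_add]
    simp
  have key2 := mul_le_mul_of_nonneg_right key (Real.exp_pos (-a)).le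
  rw [hEE] at key2
  generalize Real.eulerMascheroniConstant = g at *
  generalize Real.log a = l at *
  generalize Real.exp (-a) = E at *
  have h3 : a * (a * I) ≤ a * (l + g) + E := by
    have := mul_le_mul_of_nonneg_left h1 ha.le
    have e : a * (l + g + E / a) = a * (l + g) + E := by
      field_simp
    linarith
  refine le_of_mul_le_mul_left ?_ ha
  nlinarith
end

section
/- As γ → ∞, K_γ − ln(2γ) converges to the Euler–Mascheroni constant γ_e. -/
open Real Set Filter Topology MeasureTheory in
lemma aux_integrable : IntegrableOn (fun x : ℝ => log x * exp (-x)) (Ioi 0) := by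
  rw [← Ioc_union_Ioi_eq_Ioi (zero_le_one' ℝ)]
  refine IntegrableOn.union ?_ ?_
  · rw [← intervalIntegrable_iff_integrableOn_Ioc_of_le zero_le_one]
    exact intervalIntegral.intervalIntegrable_log'.mul_continuousOn (by fun_prop)
  · have h := (Real.GammaIntegral_convergent (s := 2) (by norm_num)).mono_set
      (Ioi_subset_Ioi (zero_le_one' ℝ))
    refine Integrable.mono' h ?_ ?_
    · exact (measurable_log.mul (by fun_prop)).aestronglyMeasurable
    · refine (ae_restrict_iff' measurableSet_Ioi).2 (Eventually.of_forall fun x hx => ?_)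
      have hx1 : (1:ℝ) < x := hx
      have h0 : 0 ≤ log x := log_nonneg hx1.le
      have h1 : log x ≤ x := (log_le_sub_one_of_pos (by linarith)).trans (by linarith)
      rw [norm_mul, norm_of_nonneg h0, norm_of_nonneg (exp_pos _).le, mul_comm]
      have : x ^ ((2:ℝ) - 1) = x := by norm_num
      rw [this]
      gcongr

open Real Set Filter Topology MeasureTheory in
lemma aux_integral : ∫ x in Ioi (0:ℝ), log x * exp (-x) = -eulerMascheroniConstant := by
  have h1 := Complex.hasDerivAt_GammaIntegral (s := 1) (by norm_num)
  have h2 : HasDerivAt Complex.GammaIntegral (-(eulerMascheroniConstant : ℂ)) 1 := by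
    refine Complex.hasDerivAt_Gamma_one.congr_of_eventuallyEq ?_
    have : {z : ℂ | 0 < z.re} ∈ 𝓝 (1:ℂ) :=
      (isOpen_lt continuous_const Complex.continuous_re).mem_nhds (by simp)
    filter_upwards [this] with z hz
    exact (Complex.Gamma_eq_integral hz).symm
  have h3 := h1.unique h2
  simp only [sub_self, Complex.cpow_zero, one_mul] at h3
  have h4 : ((∫ x in Ioi (0:ℝ), log x * exp (-x) : ℝ) : ℂ)
      = ((-eulerMascheroniConstant : ℝ) : ℂ) := by
    rw [← integral_complex_ofReal]
    push_cast at h3 ⊢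
    exact h3
  exact_mod_cast h4

open Real Set Filter Topology MeasureTheory in
lemma aux_first (a : ℝ) (ha : 0 < a) :
    a * ∫ y in (0:ℝ)..1, (-log y) * exp (-a * y)
      = log a * (1 - exp (-a)) - ∫ x in (0:ℝ)..a, log x * exp (-x) := by
  have h := intervalIntegral.integral_comp_mul_left (a := 0) (b := 1)
    (fun x : ℝ => log x * exp (-x)) ha.ne'
  rw [mul_zero, mul_one, smul_eq_mul] at h
  have hi : IntervalIntegrable (fun y : ℝ => (-log y) * exp (-a * y)) volume 0 1 :=
    intervalIntegral.intervalIntegrable_log'.neg.mul_continuousOn (by fun_prop)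
  have hj : IntervalIntegrable (fun y : ℝ => log a * exp (-a * y)) volume 0 1 :=
    Continuous.intervalIntegrable (by fun_prop) _ _
  have h2 : ∫ y in (0:ℝ)..1, log (a * y) * exp (-(a * y))
      = ∫ y in (0:ℝ)..1, (log a * exp (-a * y) - (-log y) * exp (-a * y)) := by
    refine intervalIntegral.integral_congr_ae (Eventually.of_forall fun y hy => ?_)
    rw [uIoc_of_le zero_le_one] at hy
    rw [log_mul ha.ne' hy.1.ne', neg_mul a y]
    ring
  have h3 : ∫ y in (0:ℝ)..1, log a * exp (-a * y) = log a * ((1 - exp (-a)) / a) := by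
    rw [intervalIntegral.integral_const_mul,
      intervalIntegral.integral_comp_mul_left (fun x => exp x) (neg_ne_zero.2 ha.ne')]
    simp only [integral_exp, mul_zero, mul_one, exp_zero, smul_eq_mul]
    field_simp
    ring
  rw [h2, intervalIntegral.integral_sub hj hi, h3] at h
  generalize (∫ y in (0:ℝ)..1, (-log y) * exp (-a * y)) = I at *
  generalize (∫ x in (0:ℝ)..a, log x * exp (-x)) = J at *
  field_simp at h
  linarith

open Real Set Filter Topology MeasureTheory in
lemma aux_second : Tendsto (fun a : ℝ => ∫ y in (0:ℝ)..1, a * ((-log y) * exp (-a * (1 - y))))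
    atTop (𝓝 0) := by
  have key := intervalIntegral.tendsto_integral_filter_of_dominated_convergence
    (μ := volume) (a := 0) (b := 1) (l := atTop)
    (F := fun (a : ℝ) (y : ℝ) => a * ((-log y) * exp (-a * (1 - y))))
    (f := fun _ => (0:ℝ)) (fun y => 1 + -log y) ?_ ?_ ?_ ?_
  · simpa using key
  · refine Eventually.of_forall fun a => ?_
    exact ((measurable_log.neg.mul (by fun_prop)).const_mul a).aestronglyMeasurable
  · filter_upwards [eventually_gt_atTop 0] with a ha
    refine Eventually.of_forall fun y hy => ?_
    rw [uIoc_of_le zero_le_one] at hy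
    obtain ⟨h0, h1⟩ := hy
    have hl : 0 ≤ -log y := by have := log_nonpos h0.le h1; linarith
    have hb : y * (-log y) ≤ 1 - y := by
      have := mul_le_mul_of_nonneg_left (one_sub_inv_le_log_of_pos h0) h0.le
      have h' : y * (1 - y⁻¹) = y - 1 := by field_simp
      linarith
    have hb2 : -log y ≤ (1 - y) * (1 + -log y) := by nlinarith
    have he : (a * (1 - y)) * exp (-(a * (1 - y))) ≤ 1 :=
      (mul_exp_neg_le_exp_neg_one _).trans (by rw [exp_le_one_iff]; norm_num)
    rw [norm_of_nonneg (by positivity), neg_mul a]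
    calc a * (-log y * exp (-(a * (1 - y))))
        ≤ a * (((1 - y) * (1 + -log y)) * exp (-(a * (1 - y)))) := by gcongr
      _ = ((a * (1 - y)) * exp (-(a * (1 - y)))) * (1 + -log y) := by ring
      _ ≤ 1 * (1 + -log y) := by gcongr
      _ = _ := one_mul _
  · exact (Continuous.intervalIntegrable (by fun_prop) _ _).add
      intervalIntegral.intervalIntegrable_log'.neg
  · refine Eventually.of_forall fun y hy => ?_
    rw [uIoc_of_le zero_le_one] at hy
    rcases hy.2.eq_or_lt with rfl | h1
    · simp
    · have hu : 0 < 1 - y := by linarith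
      have ht := (tendsto_pow_mul_exp_neg_atTop_nhds_zero 1).comp
        (tendsto_id.atTop_mul_const hu)
      have := ht.const_mul (-log y / (1 - y))
      rw [mul_zero] at this
      refine this.congr fun a => ?_
      simp only [Function.comp, id, pow_one, neg_mul]
      field_simp

open Real Set Filter Topology MeasureTheory in
lemma aux_main_s5 : Tendsto (fun a : ℝ => -(∫ x in (0:ℝ)..a, log x * exp (-x)) / (1 - exp (-a))
      - (∫ y in (0:ℝ)..1, a * ((-log y) * exp (-a * (1 - y)))) / (1 - exp (-a)))
    atTop (𝓝 eulerMascheroniConstant) := by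
  have h1 := intervalIntegral_tendsto_integral_Ioi 0 aux_integrable tendsto_id
  rw [aux_integral] at h1
  have h2 : Tendsto (fun a : ℝ => 1 - exp (-a)) atTop (𝓝 1) := by
    simpa using tendsto_exp_neg_atTop_nhds_zero.const_sub 1
  simpa using (h1.neg.div h2 one_ne_zero).sub (aux_second.div h2 one_ne_zero)

/-- As `γ → ∞`, `K_γ − ln(2γ)` converges to the Euler–Mascheroni constant `γ_e`. -/
theorem Ksel_sub_log_tendsto_eulerMascheroni :
    Filter.Tendsto (fun γ : ℝ => Ksel γ - Real.log (2 * γ))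
      Filter.atTop (nhds Real.eulerMascheroniConstant) := by
  have ht : Filter.Tendsto (fun γ : ℝ => 2 * γ) Filter.atTop Filter.atTop :=
    Filter.tendsto_id.const_mul_atTop two_pos
  refine (aux_main_s5.comp ht).congr' ?_
  filter_upwards [Filter.eventually_gt_atTop 0] with γ hγ
  have ha : 0 < 2 * γ := by linarith
  have hf := aux_first (2 * γ) ha
  have he : 0 < 1 - Real.exp (-(2 * γ)) := by
    have : Real.exp (-(2 * γ)) < 1 := Real.exp_zero ▸ Real.exp_lt_exp.2 (by linarith)
    linarith
  simp only [Function.comp, Ksel, omegaSel, if_neg hγ.ne', ← neg_mul]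
  simp only [mul_sub (- Real.log _)]
  have i1 : IntervalIntegrable (fun y : ℝ => -Real.log y * Real.exp (-2 * γ * y))
      MeasureTheory.volume 0 1 :=
    intervalIntegral.intervalIntegrable_log'.neg.mul_continuousOn (by fun_prop)
  have i2 : IntervalIntegrable (fun y : ℝ => -Real.log y * Real.exp (-2 * γ * (1 - y)))
      MeasureTheory.volume 0 1 :=
    intervalIntegral.intervalIntegrable_log'.neg.mul_continuousOn (by fun_prop)
  rw [intervalIntegral.integral_sub i1 i2, intervalIntegral.integral_const_mul]
  simp only [← neg_mul] at hf he
  clear i1 i2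
  generalize (∫ y in (0:ℝ)..1, (-Real.log y) * Real.exp (-2 * γ * y)) = I at *
  generalize (∫ x in (0:ℝ)..(2 * γ), Real.log x * Real.exp (-x)) = J at *
  generalize (∫ y in (0:ℝ)..1, (-Real.log y) * Real.exp (-2 * γ * (1 - y))) = L at *
  generalize 1 - Real.exp (-2 * γ) = E at *
  generalize Real.log (2 * γ) = l at *
  field_simp
  linarith
end

section
/- Let γ ≠ 0, let x ∈ (0,1), and let f : [0,1] → ℝ be twice continuously differentiable. Then ∫_0^1 ( γ y(1−y) f'(y) + (1/2) y(1−y) f''(y) ) G_γ(x,y) dy = q_γ(x)·f(1) + (1 − q_γ(x))·f(0) − f(x). -/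
/-- Fixation probability `q_γ(x) = (1 − e^{−2γx})/(1 − e^{−2γ})` for `γ ≠ 0`, `q_0(x) = x`. -/
noncomputable def qfix (γ x : ℝ) : ℝ :=
  if γ = 0 then x else (1 - Real.exp (-2 * γ * x)) / (1 - Real.exp (-2 * γ))

/-- The Wright–Fisher Green function with selection coefficient `γ ≠ 0`:
`G_γ(x,y) = q_γ(x)(1 − e^{−2γ(1−y)})/(γ y(1−y))` for `x ≤ y`, and
`G_γ(x,y) = (1 − q_γ(x))(e^{2γy} − 1)/(γ y(1−y))` for `y ≤ x`. -/
noncomputable def Gfun (γ x y : ℝ) : ℝ :=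
  if x ≤ y then qfix γ x * (1 - Real.exp (-2 * γ * (1 - y))) / (γ * y * (1 - y))
  else (1 - qfix γ x) * (Real.exp (2 * γ * y) - 1) / (γ * y * (1 - y))

/-- Integrating the Wright–Fisher generator applied to a `C²` function `f` against the
Green function gives `q_γ(x) f(1) + (1 − q_γ(x)) f(0) − f(x)`. -/
theorem integral_generator_green (γ : ℝ) (hγ : γ ≠ 0) (x : ℝ) (hx : x ∈ Set.Ioo (0:ℝ) 1)
    (f : ℝ → ℝ) (hf : ContDiffOn ℝ 2 f (Set.Icc 0 1)) :
    ∫ y in (0:ℝ)..1,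
        (γ * (y * (1 - y)) * derivWithin f (Set.Icc 0 1) y
          + (1 / 2) * (y * (1 - y)) * derivWithin (derivWithin f (Set.Icc 0 1)) (Set.Icc 0 1) y)
          * Gfun γ x y
      = qfix γ x * f 1 + (1 - qfix γ x) * f 0 - f x := by
  obtain ⟨hx0, hx1⟩ := hx
  have hU : UniqueDiffOn ℝ (Set.Icc (0:ℝ) 1) := uniqueDiffOn_Icc one_pos
  set g := derivWithin f (Set.Icc 0 1) with hg
  set h := derivWithin g (Set.Icc 0 1) with hh
  have hf0 : ContinuousOn f (Set.Icc 0 1) := hf.continuousOn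
  have hg1 : ContDiffOn ℝ 1 g (Set.Icc 0 1) := hf.derivWithin hU (by norm_num)
  have hg0 : ContinuousOn g (Set.Icc 0 1) := hg1.continuousOn
  have hh0 : ContinuousOn h (Set.Icc 0 1) := hg1.continuousOn_derivWithin hU (by norm_num)
  have hfd : ∀ y ∈ Set.Ioo (0:ℝ) 1, HasDerivAt f (g y) y := fun y hy =>
    ((hf.differentiableOn (by norm_num)) y (Set.Ioo_subset_Icc_self hy)).hasDerivWithinAt.hasDerivAt
      (Icc_mem_nhds hy.1 hy.2)
  have hgd : ∀ y ∈ Set.Ioo (0:ℝ) 1, HasDerivAt g (h y) y := fun y hy =>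
    ((hg1.differentiableOn (by norm_num)) y (Set.Ioo_subset_Icc_self hy)).hasDerivWithinAt.hasDerivAt
      (Icc_mem_nhds hy.1 hy.2)
  have key : (1 - qfix γ x) * (Real.exp (2 * γ * x) - 1)
      = qfix γ x * (1 - Real.exp (-2 * γ * (1 - x))) := by
    have hne : (1 - Real.exp (-2 * γ)) ≠ 0 := by
      rw [sub_ne_zero]
      intro h1
      have := (Real.exp_eq_one_iff _).1 h1.symm
      apply hγ
      linarith
    have e1 : Real.exp (-2 * γ * x) * Real.exp (2 * γ * x) = 1 := by
      rw [← Real.exp_add]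
      simp
    have e2 : Real.exp (-2 * γ * (1 - x)) = Real.exp (-2 * γ) * Real.exp (2 * γ * x) := by
      rw [← Real.exp_add]
      congr 1
      ring
    rw [e2]
    simp only [qfix, if_neg hγ]
    generalize Real.exp (-2 * γ) = a at *
    generalize Real.exp (-2 * γ * x) = b at *
    generalize Real.exp (2 * γ * x) = c at *
    field_simp
    linear_combination (1 - a) * e1
  generalize hq : qfix γ x = q at *
  have s1 : Set.Icc 0 x ⊆ Set.Icc (0:ℝ) 1 := Set.Icc_subset_Icc le_rfl hx1.le
  have s2 : Set.Icc x 1 ⊆ Set.Icc (0:ℝ) 1 := Set.Icc_subset_Icc hx0.le le_rfl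
  set F : ℝ → ℝ := fun y => (γ * (y * (1 - y)) * g y + (1 / 2) * (y * (1 - y)) * h y) * Gfun γ x y
    with hF
  have c1 : Set.EqOn F (fun y => (1 - q) / γ * (Real.exp (2 * γ * y) - 1) * (γ * g y + h y / 2))
      (Set.Icc 0 x) := by
    intro y hy
    simp only [hF, Gfun, hq]
    rcases eq_or_lt_of_le hy.1 with h0 | h0
    · subst h0
      simp
    have hy1 : (1 - y) ≠ 0 := by linarith [hy.2]
    split_ifs with hxy
    · have : y = x := le_antisymm hy.2 hxy
      subst this
      rw [← key]
      field_simp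
    · field_simp
  have c2 : Set.EqOn F (fun y => q / γ * (1 - Real.exp (-2 * γ * (1 - y))) * (γ * g y + h y / 2))
      (Set.Icc x 1) := by
    intro y hy
    simp only [hF, Gfun, hq, if_pos hy.1]
    rcases eq_or_lt_of_le hy.2 with h0 | h0
    · subst h0
      simp
    have hy1 : (1 - y) ≠ 0 := by linarith
    have hy0 : y ≠ 0 := by linarith [hy.1]
    field_simp
  have k1 : ContinuousOn F (Set.Icc 0 x) := by
    refine ContinuousOn.congr ?_ c1
    have := hg0.mono s1
    have := hh0.mono s1
    fun_prop
  have k2 : ContinuousOn F (Set.Icc x 1) := by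
    refine ContinuousOn.congr ?_ c2
    have := hg0.mono s2
    have := hh0.mono s2
    fun_prop
  have i1 : IntervalIntegrable F MeasureTheory.volume 0 x :=
    ContinuousOn.intervalIntegrable_of_Icc hx0.le k1
  have i2 : IntervalIntegrable F MeasureTheory.volume x 1 :=
    ContinuousOn.intervalIntegrable_of_Icc hx1.le k2
  rw [← intervalIntegral.integral_add_adjacent_intervals i1 i2]
  have v1 := intervalIntegral.integral_eq_sub_of_hasDerivAt_of_le hx0.le
    (f := fun y => (1 - q) / γ * ((Real.exp (2 * γ * y) - 1) * g y / 2 - γ * f y)) (f' := F)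
    (by
      have := hg0.mono s1
      have := hf0.mono s1
      fun_prop)
    (by
      intro y hy
      have hy' : y ∈ Set.Ioo (0:ℝ) 1 := ⟨hy.1, hy.2.trans hx1⟩
      have hE : HasDerivAt (fun y : ℝ => Real.exp (2 * γ * y)) (Real.exp (2 * γ * y) * (2 * γ)) y := by
        simpa using ((hasDerivAt_id y).const_mul (2 * γ)).exp
      rw [c1 (Set.Ioo_subset_Icc_self hy)]
      refine (((((hE.sub_const 1).mul (hgd y hy')).div_const 2).sub
        ((hfd y hy').const_mul γ)).const_mul ((1 - q) / γ)).congr_deriv ?_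
      ring) i1
  have v2 := intervalIntegral.integral_eq_sub_of_hasDerivAt_of_le hx1.le
    (f := fun y => q / γ * ((1 - Real.exp (-2 * γ * (1 - y))) * g y / 2 + γ * f y)) (f' := F)
    (by
      have := hg0.mono s2
      have := hf0.mono s2
      fun_prop)
    (by
      intro y hy
      have hy' : y ∈ Set.Ioo (0:ℝ) 1 := ⟨hx0.trans hy.1, hy.2⟩
      have hE : HasDerivAt (fun y : ℝ => Real.exp (-2 * γ * (1 - y)))
          (Real.exp (-2 * γ * (1 - y)) * (2 * γ)) y := by
        refine ((((hasDerivAt_id y).const_sub 1).const_mul (-2 * γ)).exp).congr_deriv ?_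
        simp
      rw [c2 (Set.Ioo_subset_Icc_self hy)]
      refine (((((hE.const_sub 1).mul (hgd y hy')).div_const 2).add
        ((hfd y hy').const_mul γ)).const_mul (q / γ)).congr_deriv ?_
      ring) i2
  rw [v1, v2]
  simp only [mul_zero, sub_self, Real.exp_zero, zero_mul, zero_div]
  generalize Real.exp (-2 * γ * (1 - x)) = b at *
  generalize Real.exp (2 * γ * x) = c at *
  field_simp
  linear_combination g x * key
end

section
/- For every γ ≠ 0, lim_{N→∞} ( N ∫_0^1 G_γ(1/N, y) dy − 2 ln N ) = 2(1 + K_γ), where the limit is over integers N → ∞. -/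
open Filter Topology MeasureTheory

noncomputable def Dg (γ : ℝ) : ℝ → ℝ := dslope (fun u => 1 - Real.exp (-2 * γ * u)) 0

lemma hasDeriv_f (γ x : ℝ) :
    HasDerivAt (fun u => 1 - Real.exp (-2 * γ * u)) (2 * γ * Real.exp (-2 * γ * x)) x := by
  have h := ((hasDerivAt_id x).const_mul (-2 * γ)).exp.const_sub 1
  refine HasDerivAt.congr_deriv h ?_
  simp only [id]; ring

lemma hasDeriv_r (γ x : ℝ) :
    HasDerivAt (fun u => 1 - Real.exp (-2 * γ * (1 - u)))
      (-(2 * γ * Real.exp (-2 * γ * (1 - x)))) x := by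
  have h := (((hasDerivAt_id x).const_sub 1).const_mul (-2 * γ)).exp.const_sub 1
  refine HasDerivAt.congr_deriv h ?_
  simp only [id]; ring

lemma Dg_cont (γ : ℝ) : Continuous (Dg γ) := by
  rw [← continuousOn_univ]
  refine (continuousOn_dslope univ_mem).2 ⟨by fun_prop, (hasDeriv_f γ 0).differentiableAt⟩

lemma Dg_zero (γ : ℝ) : Dg γ 0 = 2 * γ := by
  rw [Dg, dslope_same, (hasDeriv_f γ 0).deriv]; simp

lemma Dg_ne (γ : ℝ) {u : ℝ} (hu : u ≠ 0) : Dg γ u = (1 - Real.exp (-2 * γ * u)) / u := by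
  rw [Dg, dslope_of_ne _ hu, slope_def_field]; simp

lemma parts {f f' : ℝ → ℝ} (hf : ∀ x, HasDerivAt f (f' x) x) (hc : Continuous f')
    {x : ℝ} (hx : 0 < x) (hx1 : x ≤ 1) :
    ∫ y in x..1, f y * y⁻¹ = - (f x * Real.log x) - ∫ y in x..1, f' y * Real.log y := by
  have hpos : ∀ y ∈ Set.uIcc x 1, y ≠ 0 := by
    intro y hy
    rw [Set.uIcc_of_le hx1] at hy
    exact (hx.trans_le hy.1).ne'
  rw [intervalIntegral.integral_mul_deriv_eq_deriv_mul (u := f) (u' := f') (v := Real.log)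
    (v' := fun y => y⁻¹) (fun y _ => hf y) (fun y hy => Real.hasDerivAt_log (hpos y hy))
    (hc.intervalIntegrable _ _)
    (ContinuousOn.intervalIntegrable (continuousOn_id.inv₀ hpos))]
  simp

lemma prim_tendsto {f : ℝ → ℝ} (hf : ∀ a b, IntervalIntegrable f volume a b) :
    Tendsto (fun x => ∫ y in x..1, f y) (𝓝[>] 0) (𝓝 (∫ y in (0:ℝ)..1, f y)) := by
  have h := (intervalIntegral.continuous_primitive hf 1).neg
  have h2 := (h.tendsto 0).mono_left (nhdsWithin_le_nhds (s := Set.Ioi 0))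
  have e : ∀ x : ℝ, (-fun b => ∫ y in (1:ℝ)..b, f y) x = ∫ y in x..1, f y := fun x =>
    (intervalIntegral.integral_symm _ _).symm
  rw [e 0] at h2
  exact h2.congr e

lemma log_int {f : ℝ → ℝ} (hf : Continuous f) (a b : ℝ) :
    IntervalIntegrable (fun y => f y * Real.log y) volume a b :=
  (intervalIntegral.intervalIntegrable_log').continuousOn_mul hf.continuousOn

lemma mul_log_tendsto : Tendsto (fun x : ℝ => x * Real.log x) (𝓝[>] 0) (𝓝 0) := by
  have := (Real.continuous_mul_log.tendsto 0).mono_left (nhdsWithin_le_nhds (s := Set.Ioi 0))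
  simpa using this

lemma diff_log {f : ℝ → ℝ} {f' : ℝ} (hf : HasDerivAt f f' 0) :
    Tendsto (fun x : ℝ => (f x - f 0) * Real.log x) (𝓝[>] 0) (𝓝 0) := by
  have h := hf.tendsto_slope_zero_right.mul mul_log_tendsto
  rw [mul_zero] at h
  refine h.congr' ?_
  filter_upwards [self_mem_nhdsWithin] with x hx
  have : x ≠ 0 := ne_of_gt hx
  simp only [zero_add, smul_eq_mul]
  field_simp

lemma Dg_log (γ : ℝ) :
    Tendsto (fun x : ℝ => (Dg γ x - 2 * γ) * Real.log x) (𝓝[>] 0) (𝓝 0) := by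
  have h0 : Tendsto (fun x : ℝ => 4 * γ ^ 2 * |x * Real.log x|) (𝓝[>] 0) (𝓝 0) := by
    simpa using (mul_log_tendsto.abs).const_mul (4 * γ ^ 2)
  refine squeeze_zero_norm' ?_ h0
  have hs : ∀ᶠ x : ℝ in 𝓝[>] 0, |-2 * γ * x| < 1 := by
    have hc : Continuous fun x : ℝ => |-2 * γ * x| := by fun_prop
    have := (hc.tendsto 0).mono_left (nhdsWithin_le_nhds (s := Set.Ioi 0))
    refine this.eventually_lt_const (by simp)
  filter_upwards [self_mem_nhdsWithin, hs] with x hx hx1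
  have hx' : (0:ℝ) < x := hx
  have hb := Real.abs_exp_sub_one_sub_id_le hx1.le
  have e : (Dg γ x - 2 * γ) = -(Real.exp (-2 * γ * x) - 1 - (-2 * γ * x)) / x := by
    rw [Dg_ne γ hx'.ne']; field_simp; ring
  have : |Dg γ x - 2 * γ| ≤ 4 * γ ^ 2 * x := by
    rw [e, abs_div, abs_neg, abs_of_pos hx', div_le_iff₀ hx']
    nlinarith
  rw [Real.norm_eq_abs, abs_mul, abs_mul, abs_of_pos hx', ← mul_assoc]
  gcongr

lemma c_ne {γ : ℝ} (hγ : γ ≠ 0) : 1 - Real.exp (-2 * γ) ≠ 0 := by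
  intro h
  have : Real.exp (-2 * γ) = 1 := by linarith
  rw [Real.exp_eq_one_iff] at this
  exact hγ (by linarith)

lemma intD (γ : ℝ) :
    ∫ y in (0:ℝ)..1, Dg γ y = - ∫ y in (0:ℝ)..1, 2 * γ * Real.exp (-2 * γ * y) * Real.log y := by
  have h1 := prim_tendsto (f := Dg γ) (fun a b => (Dg_cont γ).intervalIntegrable a b)
  have h2 := prim_tendsto (log_int (f := fun y => 2 * γ * Real.exp (-2 * γ * y)) (by fun_prop))
  have h3 := (diff_log (hasDeriv_f γ 0)).neg.sub h2
  simp only [mul_zero, Real.exp_zero, sub_self, sub_zero, neg_zero, zero_sub] at h3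
  refine tendsto_nhds_unique h1 (h3.congr' ?_)
  filter_upwards [Ioo_mem_nhdsGT (zero_lt_one (α := ℝ))] with x hx
  rw [← parts (hasDeriv_f γ) (by fun_prop) hx.1 hx.2.le]
  refine intervalIntegral.integral_congr_Ioo_of_le hx.2.le fun y hy => ?_
  rw [Dg_ne γ (hx.1.trans hy.1).ne', div_eq_mul_inv]

lemma intG {γ : ℝ} (hγ : γ ≠ 0) {x : ℝ} (hx : 0 < x) (hx1 : x < 1) :
    ∫ y in (0:ℝ)..1, Gfun γ x y =
      (1 - qfix γ x) / γ * (∫ y in (0:ℝ)..x, Dg γ (-y) / (1 - y)) +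
      x * Dg γ x / (1 - Real.exp (-2 * γ)) / γ *
        (-((1 - Real.exp (-2 * γ * (1 - x))) * Real.log x)
          + (∫ y in x..1, 2 * γ * Real.exp (-2 * γ * (1 - y)) * Real.log y)
          + ∫ y in x..1, Dg γ (1 - y)) := by
  have hD := Dg_cont γ
  have e1 : Set.EqOn (fun y => (1 - qfix γ x) / γ * (Dg γ (-y) / (1 - y))) (Gfun γ x)
      (Set.uIoo 0 x) := by
    intro y hy
    rw [Set.uIoo_of_le hx.le] at hy
    have h1 : y ≠ 0 := hy.1.ne'
    have h2 : 1 - y ≠ 0 := by linarith [hy.2]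
    simp only [Gfun, if_neg (not_le.2 hy.2)]
    rw [Dg_ne γ (neg_ne_zero.2 h1)]
    have : -2 * γ * -y = 2 * γ * y := by ring
    rw [this]
    field_simp
    ring
  have e2 : Set.EqOn (fun y => x * Dg γ x / (1 - Real.exp (-2 * γ)) / γ *
      ((1 - Real.exp (-2 * γ * (1 - y))) * y⁻¹ + Dg γ (1 - y))) (Gfun γ x)
      (Set.uIoo x 1) := by
    intro y hy
    rw [Set.uIoo_of_le hx1.le] at hy
    have h1 : y ≠ 0 := (hx.trans hy.1).ne'
    have h2 : 1 - y ≠ 0 := by linarith [hy.2]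
    have h3 := c_ne hγ
    simp only [Gfun, if_pos hy.1.le, qfix, if_neg hγ]
    rw [Dg_ne γ h2, Dg_ne γ hx.ne']
    field_simp
    ring
  have i1 : IntervalIntegrable (fun y => (1 - qfix γ x) / γ * (Dg γ (-y) / (1 - y))) volume 0 x := by
    apply ContinuousOn.intervalIntegrable
    refine continuousOn_const.mul (ContinuousOn.div (by fun_prop) (by fun_prop) ?_)
    intro y hy
    rw [Set.uIcc_of_le hx.le] at hy
    linarith [hy.2]
  have i2a : IntervalIntegrable (fun y => (1 - Real.exp (-2 * γ * (1 - y))) * y⁻¹) volume x 1 := by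
    apply ContinuousOn.intervalIntegrable
    refine ContinuousOn.mul (by fun_prop) (continuousOn_id.inv₀ ?_)
    intro y hy
    rw [Set.uIcc_of_le hx1.le] at hy
    exact (hx.trans_le hy.1).ne'
  have i2b : IntervalIntegrable (fun y => Dg γ (1 - y)) volume x 1 :=
    Continuous.intervalIntegrable (by fun_prop) _ _
  have i2 := (i2a.add i2b).const_mul (x * Dg γ x / (1 - Real.exp (-2 * γ)) / γ)
  rw [← intervalIntegral.integral_add_adjacent_intervals (i1.congr_uIoo e1) (i2.congr_uIoo e2),
    ← intervalIntegral.integral_congr_uIoo e1, ← intervalIntegral.integral_congr_uIoo e2,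
    intervalIntegral.integral_const_mul, intervalIntegral.integral_const_mul,
    intervalIntegral.integral_add i2a i2b, parts (hasDeriv_r γ) (by fun_prop) hx hx1.le]
  simp only [neg_mul, intervalIntegral.integral_neg, sub_neg_eq_add]

lemma main_lim {γ : ℝ} (hγ : γ ≠ 0) :
    Tendsto (fun x : ℝ => x⁻¹ * (∫ y in (0:ℝ)..1, Gfun γ x y) + 2 * Real.log x)
      (𝓝[>] 0) (𝓝 (2 * (1 + Ksel γ))) := by
  have hD := Dg_cont γ
  have hc := c_ne hγ
  have a1 : Tendsto (fun x : ℝ => x⁻¹ * ∫ y in (0:ℝ)..x, Dg γ (-y) / (1 - y)) (𝓝[>] 0)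
      (𝓝 (2 * γ)) := by
    have hm : Measurable fun y => Dg γ (-y) / (1 - y) :=
      (hD.comp continuous_neg).measurable.div (by fun_prop)
    have h := intervalIntegral.integral_hasDerivAt_right (f := fun y => Dg γ (-y) / (1 - y))
      (a := 0) (b := 0) (by simp) (hm.stronglyMeasurable.stronglyMeasurableAtFilter)
      (ContinuousAt.div (by fun_prop) (by fun_prop) (by simp))
    have h2 := h.tendsto_slope_zero_right
    simpa [Dg_zero] using h2
  have a2 : Tendsto (fun x : ℝ => (1 - qfix γ x) / γ) (𝓝[>] 0) (𝓝 (1 / γ)) := by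
    have hq : Continuous fun x : ℝ => (1 - qfix γ x) / γ := by
      simp only [qfix, if_neg hγ]; fun_prop
    have := (hq.tendsto 0).mono_left (nhdsWithin_le_nhds (s := Set.Ioi 0))
    simpa [qfix, hγ] using this
  have a3 : Tendsto (Dg γ) (𝓝[>] 0) (𝓝 (2 * γ)) := by
    have := (hD.tendsto 0).mono_left (nhdsWithin_le_nhds (s := Set.Ioi 0))
    rwa [Dg_zero] at this
  have a4 := prim_tendsto
    (log_int (f := fun y => 2 * γ * Real.exp (-2 * γ * (1 - y))) (by fun_prop))
  have a5 := prim_tendsto (f := fun y => Dg γ (1 - y))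
    (fun a b => Continuous.intervalIntegrable (by fun_prop) a b)
  have a6 := diff_log (hasDeriv_r γ 0)
  have a7 : Tendsto (fun x : ℝ => 1 - Real.exp (-2 * γ * (1 - x))) (𝓝[>] 0)
      (𝓝 (1 - Real.exp (-2 * γ))) := by
    have := ((hasDeriv_r γ 0).continuousAt.tendsto).mono_left (nhdsWithin_le_nhds (s := Set.Ioi 0))
    simpa using this
  have L := ((a2.mul a1).add (((a3.div_const (1 - Real.exp (-2 * γ))).div_const γ).mul
    (a4.add a5))).sub ((((Dg_log γ).mul a7).add (a6.const_mul (2 * γ))).div_const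
      ((1 - Real.exp (-2 * γ)) * γ))
  refine (L.congr' ?_).trans (le_of_eq ?_)
  · filter_upwards [Ioo_mem_nhdsGT (zero_lt_one (α := ℝ))] with x hx
    rw [intG hγ hx.1 hx.2]
    have hx0 := hx.1.ne'
    simp only [sub_zero, mul_one]
    generalize Real.exp (-2 * γ) = E at hc ⊢
    generalize (∫ y in (0:ℝ)..x, Dg γ (-y) / (1 - y)) = I1
    generalize (∫ y in x..1, 2 * γ * Real.exp (-2 * γ * (1 - y)) * Real.log y) = I2
    generalize (∫ y in x..1, Dg γ (1 - y)) = I3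
    generalize Real.exp (-2 * γ * (1 - x)) = E2
    field_simp
    ring
  · congr 1
    have hs : ∫ y in (0:ℝ)..1, Dg γ (1 - y) = ∫ y in (0:ℝ)..1, Dg γ y := by
      simp
    have hK : (∫ y in (0:ℝ)..1,
        (-Real.log y) * (Real.exp (-2 * γ * y) - Real.exp (-2 * γ * (1 - y)))) * (2 * γ) =
        (∫ y in (0:ℝ)..1, 2 * γ * Real.exp (-2 * γ * (1 - y)) * Real.log y) -
        ∫ y in (0:ℝ)..1, 2 * γ * Real.exp (-2 * γ * y) * Real.log y := by
      rw [← intervalIntegral.integral_sub, ← intervalIntegral.integral_mul_const]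
      · congr 1; ext y; ring
      · exact log_int (f := fun y => 2 * γ * Real.exp (-2 * γ * (1 - y))) (by fun_prop) _ _
      · exact log_int (f := fun y => 2 * γ * Real.exp (-2 * γ * y)) (by fun_prop) _ _
    rw [hs, intD, ← sub_eq_add_neg, ← hK, Ksel, omegaSel, if_neg hγ]
    field_simp
    ring

/-- `N ∫_0^1 G_γ(1/N, y) dy − 2 ln N → 2(1 + K_γ)` as the integer `N → ∞`. -/
theorem green_total_mass_asymptotics (γ : ℝ) (hγ : γ ≠ 0) :
    Filter.Tendsto
      (fun N : ℕ => (N : ℝ) * (∫ y in (0:ℝ)..1, Gfun γ (1 / N) y) - 2 * Real.log N)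
      Filter.atTop (nhds (2 * (1 + Ksel γ))) := by
  have h : Tendsto (fun N : ℕ => (1 / (N:ℝ))) atTop (𝓝[>] 0) := by
    refine tendsto_nhdsWithin_iff.2 ⟨tendsto_one_div_atTop_nhds_zero_nat, ?_⟩
    filter_upwards [eventually_gt_atTop 0] with N hN
    have : (0:ℝ) < N := by exact_mod_cast hN
    exact one_div_pos.2 this
  refine ((main_lim hγ).comp h).congr fun N => ?_
  simp only [Function.comp, one_div, inv_inv, Real.log_inv]
  ring
end

section
/- Let V be a finite set, θ : V × V → ℝ nonnegative with θ_{uu} = 0, γ : V × V → ℝ antisymmetric (γ_{uv} = −γ_{vu}), and let η be a probability vector on V satisfying the detailed balance equations η_u θ_{uv} ω_{γ_{uv}} = η_v θ_{vu} ω_{γ_{vu}} for all u,v ∈ V. Then ∑_{u,v ∈ V} η_u θ_{uv} K_{γ_{uv}} ≤ 0. -/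
theorem omegaSel_nonneg_aux (g : ℝ) : 0 ≤ omegaSel g := by
  unfold omegaSel
  split_ifs with h
  · norm_num
  · rcases lt_or_gt_of_ne h with h | h
    · apply div_nonneg_of_nonpos
      · linarith
      · have := Real.one_le_exp (x := -2 * g) (by linarith)
        linarith
    · apply div_nonneg
      · linarith
      · have := Real.exp_le_one_iff (x := -2 * g) |>.2 (by linarith)
        linarith

noncomputable def Isel (g : ℝ) : ℝ :=
  ∫ y in (0:ℝ)..1, (-Real.log y) * (Real.exp (-2 * g * y) - Real.exp (-2 * g * (1 - y)))

theorem log_mul_integrable_aux (f : ℝ → ℝ) (hf : Continuous f) :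
    IntervalIntegrable (fun y => (-Real.log y) * f y) MeasureTheory.volume 0 1 :=
  (intervalIntegral.intervalIntegrable_log').neg.mul_continuousOn hf.continuousOn

theorem cosh_diff_aux (g y : ℝ) (h0 : 0 < y) (h1 : y < 1) :
    (Real.log (1 - y) - Real.log y) *
      (Real.cosh (2 * g * y) - Real.cosh (2 * g * (1 - y))) ≤ 0 := by
  rcases le_total y (1 - y) with h | h
  · apply mul_nonpos_of_nonneg_of_nonpos
    · have := Real.log_le_log h0 h
      linarith
    · have : Real.cosh (2 * g * y) ≤ Real.cosh (2 * g * (1 - y)) := by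
        rw [Real.cosh_le_cosh, abs_mul, abs_mul _ (1 - y), abs_of_pos h0,
          abs_of_pos (by linarith : 0 < 1 - y)]
        gcongr
      linarith
  · apply mul_nonpos_of_nonpos_of_nonneg
    · have := Real.log_le_log (by linarith) h
      linarith
    · have : Real.cosh (2 * g * (1 - y)) ≤ Real.cosh (2 * g * y) := by
        rw [Real.cosh_le_cosh, abs_mul, abs_mul _ y, abs_of_pos h0,
          abs_of_pos (by linarith : 0 < 1 - y)]
        gcongr
      linarith

theorem Isel_add_neg (g : ℝ) : Isel g + Isel (-g) ≤ 0 := by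
  let F : ℝ → ℝ := fun y =>
    (-Real.log y) * (2 * (Real.cosh (2 * g * y) - Real.cosh (2 * g * (1 - y))))
  have hFi : IntervalIntegrable F MeasureTheory.volume 0 1 :=
    log_mul_integrable_aux _ (by fun_prop)
  have hFi' : IntervalIntegrable (fun y => F (1 - y)) MeasureTheory.volume 0 1 := by
    have := (hFi.comp_sub_left 1).symm
    simpa using this
  have h1 : Isel g + Isel (-g) = ∫ y in (0:ℝ)..1, F y := by
    unfold Isel
    rw [← intervalIntegral.integral_add
      (log_mul_integrable_aux _ (by fun_prop)) (log_mul_integrable_aux _ (by fun_prop))]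
    congr 1
    ext y
    simp only [F, Real.cosh_eq]
    ring_nf
  have h2 : ∫ y in (0:ℝ)..1, F (1 - y) = ∫ y in (0:ℝ)..1, F y := by
    rw [intervalIntegral.integral_comp_sub_left]; norm_num
  have h3 : (∫ y in (0:ℝ)..1, (F y + F (1 - y))) ≤ ∫ y in (0:ℝ)..1, (0:ℝ) := by
    apply intervalIntegral.integral_mono_on_of_le_Ioo (by norm_num) (hFi.add hFi') (by simp)
    intro y hy
    have := cosh_diff_aux g y hy.1 hy.2
    have e : F y + F (1 - y) = 2 * ((Real.log (1 - y) - Real.log y) *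
      (Real.cosh (2 * g * y) - Real.cosh (2 * g * (1 - y)))) := by
      simp only [F, sub_sub_cancel]
      ring
    linarith
  rw [intervalIntegral.integral_add hFi hFi', h2] at h3
  simp at h3
  linarith

/-- Under detailed balance with antisymmetric selection coefficients, the
`K`-weighted total mutation flow is nonpositive: `∑_{u,v} η_u θ_{uv} K_{γ_{uv}} ≤ 0`. -/
theorem sum_K_weighted_nonpos {V : Type*} [Fintype V]
    (θ : V → V → ℝ) (hθ : ∀ u v, 0 ≤ θ u v) (hθdiag : ∀ u, θ u u = 0)
    (γ : V → V → ℝ) (hγ : ∀ u v, γ u v = -γ v u)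
    (η : V → ℝ) (hη0 : ∀ u, 0 ≤ η u) (hη1 : ∑ u, η u = 1)
    (hdb : ∀ u v, η u * θ u v * omegaSel (γ u v) = η v * θ v u * omegaSel (γ v u)) :
    ∑ u, ∑ v, η u * θ u v * Ksel (γ u v) ≤ 0 := by
  have hS : ∑ u, ∑ v, η u * θ u v * Ksel (γ u v) = ∑ u, ∑ v, η v * θ v u * Ksel (γ v u) :=
    Finset.sum_comm
  have h : ∑ u, ∑ v, (η u * θ u v * Ksel (γ u v) + η v * θ v u * Ksel (γ v u)) ≤ 0 := by
    apply Finset.sum_nonpos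
    intro u _
    apply Finset.sum_nonpos
    intro v _
    have hK : ∀ g, Ksel g = omegaSel g * Isel g := fun g => rfl
    have e : η u * θ u v * Ksel (γ u v) + η v * θ v u * Ksel (γ v u)
        = (η u * θ u v * omegaSel (γ u v)) * (Isel (γ u v) + Isel (-γ u v)) := by
      rw [← hγ v u, hK, hK, mul_add, ← mul_assoc, ← mul_assoc, ← hdb u v]
    rw [e]
    exact mul_nonpos_of_nonneg_of_nonpos
      (mul_nonneg (mul_nonneg (hη0 u) (hθ u v)) (omegaSel_nonneg_aux _)) (Isel_add_neg _)
  simp only [Finset.sum_add_distrib] at h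
  linarith
end

section
/- Let V be a finite set, θ : V × V → ℝ nonnegative with θ_{uu} = 0, γ : V × V → ℝ antisymmetric (γ_{uv} = −γ_{vu}), and let η be a probability vector on V satisfying the detailed balance equations η_u θ_{uv} ω_{γ_{uv}} = η_v θ_{vu} ω_{γ_{vu}} for all u,v ∈ V. Then for every y with 0 < y < 1, ∑_{u,v ∈ V} η_u θ_{uv} ( 1 − ω_{γ_{uv}} J_{γ_{uv}}(y) ) ≥ 0, where J_γ(y) = (1 − e^{−2γ(1−y)})/(2γ(1−y)) for γ ≠ 0 and J_0(y) = 1. -/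
/-- `J_γ(y) = (1 − e^{−2γ(1−y)})/(2γ(1−y))` for `γ ≠ 0`, and `J_0(y) = 1`. -/
noncomputable def Jfun (γ y : ℝ) : ℝ :=
  if γ = 0 then 1 else (1 - Real.exp (-2 * γ * (1 - y))) / (2 * γ * (1 - y))

lemma sinh_mul_le (t : ℝ) (h0 : 0 < t) (h1 : t < 1) (g : ℝ) (hg : 0 ≤ g) :
    Real.sinh (t * g) ≤ t * Real.sinh g := by
  have hd : ∀ x : ℝ, HasDerivAt (fun x => t * Real.sinh x - Real.sinh (t * x))
      (t * Real.cosh x - Real.cosh (t * x) * (t * 1)) x := by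
    intro x
    exact ((Real.hasDerivAt_sinh x).const_mul t).sub
      ((Real.hasDerivAt_sinh (t * x)).comp x ((hasDerivAt_id x).const_mul t))
  have hm : MonotoneOn (fun x => t * Real.sinh x - Real.sinh (t * x)) (Set.Ici 0) := by
    apply monotoneOn_of_deriv_nonneg (convex_Ici 0)
    · exact fun x _ => (hd x).continuousAt.continuousWithinAt
    · exact fun x _ => (hd x).differentiableAt.differentiableWithinAt
    · intro x hx
      rw [interior_Ici] at hx
      have hx : 0 < x := hx
      rw [(hd x).deriv]
      have : Real.cosh (t * x) ≤ Real.cosh x := by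
        rw [Real.cosh_le_cosh, abs_of_pos (by positivity), abs_of_pos hx]
        nlinarith
      nlinarith
  have := hm (Set.mem_Ici.2 le_rfl) (Set.mem_Ici.2 hg) hg
  simp at this
  linarith

lemma omegaSel_pos (g : ℝ) : 0 < omegaSel g := by
  unfold omegaSel
  split_ifs with h
  · norm_num
  · rcases lt_or_gt_of_ne h with h | h
    · apply div_pos_of_neg_of_neg (by linarith)
      have : 1 < Real.exp (-2 * g) := Real.one_lt_exp_iff.2 (by linarith)
      linarith
    · apply div_pos (by linarith)
      have : Real.exp (-2 * g) < 1 := Real.exp_lt_one_iff.2 (by linarith)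
      linarith

lemma key_pos (g y : ℝ) (hy : y ∈ Set.Ioo (0:ℝ) 1) (hg : 0 < g) :
    Jfun g y + Jfun (-g) y ≤ (omegaSel g)⁻¹ + (omegaSel (-g))⁻¹ := by
  obtain ⟨hy0, hy1⟩ := hy
  have ht : 0 < 1 - y := by linarith
  have h := sinh_mul_le (1 - y) ht (by linarith) (2 * g) (by linarith)
  have e1 : Jfun g y + Jfun (-g) y = Real.sinh ((1 - y) * (2 * g)) / (g * (1 - y)) := by
    unfold Jfun
    rw [if_neg hg.ne', if_neg (by linarith), Real.sinh_eq,
      show -2 * g * (1 - y) = -((1 - y) * (2 * g)) by ring,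
      show -2 * -g * (1 - y) = ((1 - y) * (2 * g)) by ring]
    field_simp
    ring
  have e2 : (omegaSel g)⁻¹ + (omegaSel (-g))⁻¹ = Real.sinh (2 * g) / g := by
    unfold omegaSel
    rw [if_neg hg.ne', if_neg (by linarith), Real.sinh_eq, inv_div, inv_div,
      show -2 * g = -(2 * g) by ring,
      show -2 * -g = 2 * g by ring]
    field_simp
    ring
  rw [e1, e2, div_le_div_iff₀ (by positivity) hg]
  nlinarith

lemma key (g y : ℝ) (hy : y ∈ Set.Ioo (0:ℝ) 1) :
    Jfun g y + Jfun (-g) y ≤ (omegaSel g)⁻¹ + (omegaSel (-g))⁻¹ := by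
  rcases lt_trichotomy g 0 with h | h | h
  · have := key_pos (-g) y hy (by linarith)
    rw [neg_neg] at this
    linarith
  · subst h
    simp [Jfun, omegaSel]
  · exact key_pos g y hy h

/-- Under detailed balance with antisymmetric selection coefficients, the integrand of the
remainder term `R_N` is nonnegative:
`∑_{u,v} η_u θ_{uv} (1 − ω_{γ_{uv}} J_{γ_{uv}}(y)) ≥ 0` for every `0 < y < 1`. -/
theorem remainder_integrand_nonneg {V : Type*} [Fintype V]
    (θ : V → V → ℝ) (hθ : ∀ u v, 0 ≤ θ u v) (hθdiag : ∀ u, θ u u = 0)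
    (γ : V → V → ℝ) (hγ : ∀ u v, γ u v = -γ v u)
    (η : V → ℝ) (hη0 : ∀ u, 0 ≤ η u) (hη1 : ∑ u, η u = 1)
    (hdb : ∀ u v, η u * θ u v * omegaSel (γ u v) = η v * θ v u * omegaSel (γ v u))
    (y : ℝ) (hy : y ∈ Set.Ioo (0:ℝ) 1) :
    0 ≤ ∑ u, ∑ v, η u * θ u v * (1 - omegaSel (γ u v) * Jfun (γ u v) y) := by
  set F : V → V → ℝ := fun u v => η u * θ u v * (1 - omegaSel (γ u v) * Jfun (γ u v) y) with hF
  have hsym : ∑ u, ∑ v, F u v = ∑ u, ∑ v, F v u := Finset.sum_comm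
  have hpos : 0 ≤ ∑ u, ∑ v, (F u v + F v u) := by
    refine Finset.sum_nonneg fun u _ => Finset.sum_nonneg fun v _ => ?_
    have h1 : ∀ u v, F u v = η u * θ u v * omegaSel (γ u v) *
        ((omegaSel (γ u v))⁻¹ - Jfun (γ u v) y) := by
      intro u v
      have := (omegaSel_pos (γ u v)).ne'
      simp only [hF]
      field_simp
    rw [h1 u v, h1 v u, ← hdb u v, ← mul_add]
    apply mul_nonneg
    · exact mul_nonneg (mul_nonneg (hη0 u) (hθ u v)) (omegaSel_pos _).le
    · have := key (γ u v) y hy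
      rw [hγ v u]
      linarith
  simp only [Finset.sum_add_distrib] at hpos
  change 0 ≤ ∑ u, ∑ v, F u v
  linarith
end

section
/- (Corollary: homogeneous mutation rates.) In the multi-locus Wright–Fisher graph setup, assume θ_u = θ > 0 for every u ∈ V, and that the integer N satisfies N ≥ 2 and N ≥ 4C² where C = max_{j,u,v} |γ^j_{uv}|. Then θ̂ = θ and θ/(1 + 2L^{−1}(1+ln N)θ) ≤ θ̂_eff ≤ θ. -/
open MeasureTheory intervalIntegral in
lemma aux_ii (h : ℝ → ℝ) (hc : Continuous h) (a b : ℝ) :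
    IntervalIntegrable (fun y => (-Real.log y) * h y) volume a b :=
  (intervalIntegral.intervalIntegrable_log' (a := a) (b := b)).neg.mul_continuousOn hc.continuousOn

lemma aux_anti (h : ℝ → ℝ) (hc : Continuous h) (hs : ∀ y, h (1 - y) = - h y)
    (hle : ∀ y, 0 < y → y ≤ 1 / 2 → h y ≤ 0) :
    ∫ y in (0:ℝ)..1, (-Real.log y) * h y ≤ 0 := by
  have hi := aux_ii h hc 0 1
  have e1 : ∫ y in (0:ℝ)..1, (-Real.log (1 - y)) * h (1 - y)
      = ∫ y in (0:ℝ)..1, (-Real.log y) * h y := by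
    have := intervalIntegral.integral_comp_sub_left (a := 0) (b := 1)
      (fun y => (-Real.log y) * h y) 1
    simpa using this
  have hi2 : IntervalIntegrable (fun y => (-Real.log (1 - y)) * h (1 - y))
      MeasureTheory.volume 0 1 := by
    have := hi.comp_sub_left 1
    simpa using this.symm
  have e2 : ∫ y in (0:ℝ)..1, ((-Real.log y) * h y + (-Real.log (1 - y)) * h (1 - y))
      = 2 * ∫ y in (0:ℝ)..1, (-Real.log y) * h y := by
    rw [intervalIntegral.integral_add hi hi2, e1]; ring
  have e3 : 0 ≤ ∫ y in (0:ℝ)..1, -((-Real.log y) * h y + (-Real.log (1 - y)) * h (1 - y)) := by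
    rw [intervalIntegral.integral_of_le zero_le_one,
      ← MeasureTheory.integral_Ioc_eq_integral_Ioo.symm]
    apply MeasureTheory.setIntegral_nonneg measurableSet_Ioo
    rintro y ⟨h0, h1⟩
    rw [hs]
    have : 0 ≤ (Real.log (1 - y) - Real.log y) * (- h y) := by
      rcases le_total y (1 / 2) with hy | hy
      · apply mul_nonneg
        · have := Real.log_le_log h0 (by linarith : y ≤ 1 - y)
          linarith
        · linarith [hle y h0 hy]
      · apply mul_nonneg_of_nonpos_of_nonpos
        · have := Real.log_le_log (by linarith) (by linarith : 1 - y ≤ y)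
          linarith
        · have := hle (1 - y) (by linarith) (by linarith)
          rw [hs] at this; linarith
    nlinarith
  rw [intervalIntegral.integral_neg, e2] at e3
  linarith

lemma omega_pos (γ : ℝ) : 0 < omegaSel γ := by
  unfold omegaSel
  split_ifs with h
  · exact one_pos
  · rcases lt_or_gt_of_ne h with h | h
    · apply div_pos_of_neg_of_neg (by linarith)
      have := Real.one_lt_exp_iff.2 (by linarith : 0 < -2 * γ)
      linarith
    · apply div_pos (by linarith)
      have := Real.exp_lt_one_iff.2 (by linarith : -2 * γ < 0)
      linarith

noncomputable def Iaux (γ : ℝ) : ℝ :=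
  ∫ y in (0:ℝ)..1, (-Real.log y) * (Real.exp (-2 * γ * y) - Real.exp (-2 * γ * (1 - y)))

lemma Ksel_eq (γ : ℝ) : Ksel γ = omegaSel γ * Iaux γ := rfl

lemma I_symm (γ : ℝ) : Iaux γ + Iaux (-γ) ≤ 0 := by
  unfold Iaux
  rw [← intervalIntegral.integral_add (aux_ii _ (by fun_prop) _ _) (aux_ii _ (by fun_prop) _ _)]
  have := aux_anti (fun y => 2 * Real.cosh (2 * γ * y) - 2 * Real.cosh (2 * γ * (1 - y)))
    (by have := Real.continuous_cosh; fun_prop) (by intro y; ring_nf) (by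
      intro y h0 h1
      have : Real.cosh (2 * γ * y) ≤ Real.cosh (2 * γ * (1 - y)) := by
        rw [Real.cosh_le_cosh, abs_mul, abs_mul _ (1 - y)]
        apply mul_le_mul_of_nonneg_left _ (abs_nonneg _)
        rw [abs_of_pos h0, abs_of_pos (by linarith)]
        linarith
      linarith)
  convert this using 3 with y
  rw [Real.cosh_eq, Real.cosh_eq]
  ring_nf

lemma I_nonneg (γ : ℝ) (h : 0 ≤ γ) : 0 ≤ Iaux γ := by
  have := aux_anti (fun y => -(Real.exp (-2 * γ * y) - Real.exp (-2 * γ * (1 - y))))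
    (by fun_prop) (by intro y; ring_nf) (by
      intro y h0 h1
      have : Real.exp (-2 * γ * (1 - y)) ≤ Real.exp (-2 * γ * y) := by
        apply Real.exp_le_exp.2; nlinarith
      linarith)
  simp only [mul_neg, intervalIntegral.integral_neg] at this
  unfold Iaux
  simp only [neg_mul, intervalIntegral.integral_neg] at this ⊢
  linarith

lemma int_bound (a M : ℝ) (ha : 0 < a) (hM : 1 ≤ M) :
    ∫ y in (0:ℝ)..1, (-Real.log y) * Real.exp (-a * y) ≤
      Real.log M * ((1 - Real.exp (-a)) / a) + 1 / M := by
  have hM0 : 0 < M := by linarith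
  have hinv : 1 / M ≤ 1 := by rw [div_le_one hM0]; exact hM
  have hinv0 : 0 < 1 / M := by positivity
  have hE : ∫ y in (0:ℝ)..1, Real.exp (-a * y) = (1 - Real.exp (-a)) / a := by
    rw [intervalIntegral.integral_comp_mul_left (fun x => Real.exp x) (by linarith : -a ≠ 0), integral_exp]
    simp only [mul_zero, mul_one, Real.exp_zero, smul_eq_mul]
    field_simp
    ring
  have hlog : Real.log (1 / M) = - Real.log M := by simp
  have ii : ∀ p q : ℝ, IntervalIntegrable (fun y => (-Real.log y) * Real.exp (-a * y)
      - Real.log M * Real.exp (-a * y)) MeasureTheory.volume p q := fun p q =>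
    (aux_ii _ (by fun_prop) _ _).sub (Continuous.intervalIntegrable (by fun_prop) _ _)
  have e : ∫ y in (0:ℝ)..1, ((-Real.log y) * Real.exp (-a * y) - Real.log M * Real.exp (-a * y))
      ≤ 1 / M := by
    rw [← intervalIntegral.integral_add_adjacent_intervals (ii 0 (1 / M)) (ii (1 / M) 1)]
    have h1 : ∫ y in (0:ℝ)..(1/M), ((-Real.log y) * Real.exp (-a * y)
        - Real.log M * Real.exp (-a * y)) ≤ ∫ y in (0:ℝ)..(1/M), (-Real.log y - Real.log M) := by
      apply intervalIntegral.integral_mono_on_of_le_Ioo hinv0.le (ii _ _)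
      · exact (intervalIntegral.intervalIntegrable_log').neg.sub (by simp)
      · rintro y ⟨h0, h1⟩
        have := Real.log_le_log h0 h1.le
        have h3 : Real.exp (-a * y) ≤ 1 := Real.exp_le_one_iff.2 (by nlinarith)
        nlinarith
    have h2 : ∫ y in (0:ℝ)..(1/M), (-Real.log y - Real.log M) = 1 / M := by
      rw [intervalIntegral.integral_sub (f := fun y => -Real.log y) (g := fun _ => Real.log M)
        (intervalIntegral.intervalIntegrable_log').neg (by simp),
        intervalIntegral.integral_neg, integral_log, hlog]
      simp
    have h3 : ∫ y in (1/M)..1, ((-Real.log y) * Real.exp (-a * y)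
        - Real.log M * Real.exp (-a * y)) ≤ ∫ y in (1/M)..1, (0:ℝ) := by
      apply intervalIntegral.integral_mono_on_of_le_Ioo hinv (ii _ _) (by simp)
      rintro y ⟨h0, h1⟩
      have := Real.log_le_log hinv0 h0.le
      have h3 := Real.exp_pos (-a * y)
      nlinarith
    simp only [intervalIntegral.integral_zero] at h3
    linarith
  rw [intervalIntegral.integral_sub (aux_ii _ (by fun_prop) _ _)
    (Continuous.intervalIntegrable (by fun_prop) _ _), intervalIntegral.integral_const_mul, hE] at e
  linarith

lemma exp_bound (a M : ℝ) (ha : 0 < a) (hM : 2 ≤ M) (haM : a ^ 2 ≤ M) :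
    a / M ≤ 1 - Real.exp (-a) := by
  have hM0 : 0 < M := by linarith
  have hp := Real.exp_pos a
  rw [Real.exp_neg]
  rcases le_total (a ^ 2) 2 with h | h
  · have h3 : 1 + a + a ^ 2 / 2 + a ^ 3 / 6 ≤ Real.exp a := by
      have := Real.sum_le_exp_of_nonneg ha.le 4
      simp [Finset.sum_range_succ, Nat.factorial] at this
      linarith
    have h5 : a ≤ 3 / 2 := by nlinarith
    have h4 : (Real.exp a)⁻¹ ≤ 1 - a / 2 := by
      rw [inv_le_iff_one_le_mul₀ hp]
      have : 1 ≤ (1 - a / 2) * (1 + a + a ^ 2 / 2 + a ^ 3 / 6) := by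
        have : 0 ≤ a * (6 - a ^ 2 - a ^ 2 * a) := by
          apply mul_nonneg ha.le; nlinarith
        nlinarith
      have : (1 - a / 2) * (1 + a + a ^ 2 / 2 + a ^ 3 / 6) ≤ (1 - a / 2) * Real.exp a :=
        mul_le_mul_of_nonneg_left h3 (by linarith)
      linarith
    have : a / M ≤ a / 2 := by gcongr
    linarith
  · have h3 : 1 + a + a ^ 2 / 2 ≤ Real.exp a := Real.quadratic_le_exp_of_nonneg ha.le
    have h5 : 1 ≤ a := by nlinarith
    have h4 : (Real.exp a)⁻¹ ≤ 1 - 1 / a := by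
      rw [inv_le_iff_one_le_mul₀ hp]
      have h6 : 0 ≤ 1 - 1 / a := by
        rw [sub_nonneg, div_le_one ha]; exact h5
      have h7 : 1 ≤ (1 - 1 / a) * (1 + a + a ^ 2 / 2) := by
        have : (1 - 1 / a) * (1 + a + a ^ 2 / 2) - 1 = (a + 1) * (a ^ 2 / 2 - 1) / a := by
          field_simp; ring
        have : 0 ≤ (a + 1) * (a ^ 2 / 2 - 1) / a :=
          div_nonneg (mul_nonneg (by linarith) (by linarith)) ha.le
        linarith
      have := mul_le_mul_of_nonneg_left h3 h6
      linarith
    have : a / M ≤ 1 / a := by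
      rw [div_le_div_iff₀ hM0 ha]; nlinarith
    linarith

lemma K_lower (γ M : ℝ) (hM : 2 ≤ M) (h : 4 * γ ^ 2 ≤ M) : 0 ≤ 1 + Real.log M + Ksel γ := by
  have hlog : 0 ≤ Real.log M := Real.log_nonneg (by linarith)
  rw [Ksel_eq]
  rcases le_or_gt 0 γ with hγ | hγ
  · have := mul_nonneg (omega_pos γ).le (I_nonneg γ hγ)
    linarith
  · obtain ⟨a, rfl⟩ : ∃ a, γ = -a / 2 := ⟨-2 * γ, by ring⟩
    have ha : 0 < a := by linarith
    have hb := int_bound a M ha (by linarith)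
    have he := exp_bound a M ha hM (by nlinarith)
    set J := ∫ y in (0:ℝ)..1, (-Real.log y) * Real.exp (-a * y) with hJ
    have hI : -(Real.exp a * J) ≤ Iaux (-a / 2) := by
      unfold Iaux
      rw [hJ, ← intervalIntegral.integral_const_mul, ← intervalIntegral.integral_neg]
      apply intervalIntegral.integral_mono_on_of_le_Ioo zero_le_one
      · exact ((aux_ii _ (by fun_prop) _ _).const_mul _).neg
      · exact aux_ii _ (by fun_prop) _ _
      · rintro y ⟨h0, h1⟩
        have h2 : Real.exp (-2 * (-a / 2) * (1 - y)) = Real.exp a * Real.exp (-a * y) := by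
          rw [← Real.exp_add]; ring_nf
        rw [h2]
        have h3 := Real.log_nonpos h0.le h1.le
        have h4 := Real.exp_pos (-2 * (-a / 2) * y)
        nlinarith
    have hx : Real.exp (-a) < 1 := Real.exp_lt_one_iff.2 (by linarith)
    have hD : 0 < 1 - Real.exp (-a) := by linarith
    have hw : omegaSel (-a / 2) * Real.exp a = a / (1 - Real.exp (-a)) := by
      unfold omegaSel
      rw [if_neg (by linarith)]
      have h1 : Real.exp (-2 * (-a / 2)) = Real.exp a := by ring_nf
      have h2 : 1 < Real.exp a := Real.one_lt_exp_iff.2 ha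
      have h3 : 1 - Real.exp a ≠ 0 := by linarith
      have h4 : Real.exp a * Real.exp (-a) = 1 := by rw [← Real.exp_add]; simp
      rw [h1, div_mul_eq_mul_div, div_eq_div_iff h3 hD.ne']
      linear_combination a * h4
    have h1 := mul_le_mul_of_nonneg_left hI (omega_pos (-a / 2)).le
    have h2 : a / (1 - Real.exp (-a)) * J ≤ Real.log M + 1 := by
      have := mul_le_mul_of_nonneg_left hb (div_pos ha hD).le
      have h3 : a / (1 - Real.exp (-a)) * (Real.log M * ((1 - Real.exp (-a)) / a) + 1 / M)
          = Real.log M + (a / M) / (1 - Real.exp (-a)) := by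
        field_simp
      have h4 : (a / M) / (1 - Real.exp (-a)) ≤ 1 := by rw [div_le_one hD]; exact he
      linarith
    rw [← hw] at h2
    nlinarith

/-- Homogeneous mutation rates: if `θ_u = θ > 0` for all `u`, then `θ̂ = θ` and
`θ/(1 + 2L⁻¹(1+ln N)θ) ≤ θ̂_eff ≤ θ`. -/
theorem homogeneous_mutation_rate_bounds {V : Type*} [Fintype V] [Nonempty V]
    (L N : ℕ) (hL : 1 ≤ L) (hN : 2 ≤ N)
    (θ : V → V → ℝ) (hθ : ∀ u v, 0 ≤ θ u v) (hθdiag : ∀ u, θ u u = 0)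
    (θ0 : ℝ) (hθ0pos : 0 < θ0) (hhom : ∀ u, ∑ v, θ u v = θ0)
    (γ : Fin L → V → V → ℝ) (hγ : ∀ j u v, γ j u v = -γ j v u)
    (η : Fin L → V → ℝ) (hη0 : ∀ j u, 0 ≤ η j u) (hη1 : ∀ j, ∑ u, η j u = 1)
    (hdb : ∀ j u v,
      η j u * θ u v * omegaSel (γ j u v) = η j v * θ v u * omegaSel (γ j v u))
    (C : ℝ) (hC : ∀ j u v, |γ j u v| ≤ C) (hNC : 4 * C ^ 2 ≤ (N : ℝ))
    (Ω : Fin L → ℝ)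
    (hΩ : ∀ j, Ω j = 1 + (2 / L) *
      ∑ u, ∑ v, η j u * θ u v * (1 + Real.log N + Ksel (γ j u v)))
    (θhat : Fin L → ℝ) (hθhat : ∀ j, θhat j = ∑ u, η j u * (∑ v, θ u v))
    (θbar θeff : ℝ)
    (hθbar : θbar = (1 / L) * ∑ j, θhat j)
    (hθeff : θeff = (1 / L) * ∑ j, θhat j / Ω j) :
    θbar = θ0 ∧
    θ0 / (1 + 2 / L * (1 + Real.log N) * θ0) ≤ θeff ∧ θeff ≤ θ0 := by
  have hLr : (0:ℝ) < L := by exact_mod_cast hL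
  have hNr : (2:ℝ) ≤ N := by exact_mod_cast hN
  have hlog : 0 ≤ Real.log N := Real.log_nonneg (by linarith)
  have hhat : ∀ j, θhat j = θ0 := by
    intro j
    rw [hθhat]
    simp only [hhom]
    rw [← Finset.sum_mul, hη1, one_mul]
  have hS0 : ∀ j, 0 ≤ ∑ u, ∑ v, η j u * θ u v * (1 + Real.log N + Ksel (γ j u v)) := by
    intro j
    refine Finset.sum_nonneg fun u _ => Finset.sum_nonneg fun v _ =>
      mul_nonneg (mul_nonneg (hη0 j u) (hθ u v)) (K_lower _ _ hNr ?_)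
    have := sq_le_sq' (by linarith [neg_abs_le (γ j u v), hC j u v])
      ((le_abs_self _).trans (hC j u v))
    linarith
  have hK : ∀ j, ∑ u, ∑ v, η j u * θ u v * Ksel (γ j u v) ≤ 0 := by
    intro j
    have e : ∑ u, ∑ v, η j u * θ u v * Ksel (γ j u v)
        = ∑ u, ∑ v, η j u * θ u v * omegaSel (γ j u v) * Iaux (-(γ j u v)) := by
      rw [Finset.sum_comm]
      refine Finset.sum_congr rfl fun u _ => Finset.sum_congr rfl fun v _ => ?_
      rw [hdb j u v, ← hγ j v u, Ksel_eq]; ring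
    have e2 : ∑ u, ∑ v, (η j u * θ u v * Ksel (γ j u v) +
        η j u * θ u v * omegaSel (γ j u v) * Iaux (-(γ j u v))) ≤ 0 := by
      refine Finset.sum_nonpos fun u _ => Finset.sum_nonpos fun v _ => ?_
      have h1 : 0 ≤ η j u * θ u v * omegaSel (γ j u v) :=
        mul_nonneg (mul_nonneg (hη0 j u) (hθ u v)) (omega_pos _).le
      have h2 := mul_nonpos_of_nonneg_of_nonpos h1 (I_symm (γ j u v))
      rw [Ksel_eq]
      linarith
    simp only [Finset.sum_add_distrib] at e2
    linarith
  have hS1 : ∀ j, ∑ u, ∑ v, η j u * θ u v * (1 + Real.log N + Ksel (γ j u v))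
      ≤ (1 + Real.log N) * θ0 := by
    intro j
    have h1 : ∑ u, ∑ v, η j u * θ u v = θ0 := by
      rw [← hhat j, hθhat]
      simp only [Finset.mul_sum]
    simp only [mul_add _ (1 + Real.log (N:ℝ)), Finset.sum_add_distrib, ← Finset.sum_mul]
    rw [h1]
    linarith [hK j]
  have hc : (0:ℝ) < 2 / L := by positivity
  have hΩ1 : ∀ j, 1 ≤ Ω j := by
    intro j
    rw [hΩ]
    linarith [mul_nonneg hc.le (hS0 j)]
  have hΩ2 : ∀ j, Ω j ≤ 1 + 2 / L * (1 + Real.log N) * θ0 := by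
    intro j
    rw [hΩ]
    linarith [mul_le_mul_of_nonneg_left (hS1 j) hc.le]
  have hconst : ∀ x : ℝ, (1 / (L:ℝ)) * ∑ _j : Fin L, x = x := by
    intro x
    simp
    field_simp
  refine ⟨?_, ?_, ?_⟩
  · rw [hθbar]
    simp only [hhat]
    exact hconst _
  · rw [hθeff, ← hconst (θ0 / _)]
    refine mul_le_mul_of_nonneg_left (Finset.sum_le_sum fun j _ => ?_) (by positivity)
    rw [hhat]
    exact div_le_div_of_nonneg_left hθ0pos.le (by linarith [hΩ1 j]) (hΩ2 j)
  · rw [hθeff]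
    conv_rhs => rw [← hconst θ0]
    refine mul_le_mul_of_nonneg_left (Finset.sum_le_sum fun j _ => ?_) (by positivity)
    rw [hhat]
    exact div_le_self hθ0pos.le (hΩ1 j)
end

section
/- For every real γ > 0 and every real N with N ≥ 2 and N ≥ 4γ², one has K_γ ≤ ((1 − e^{−2γ})/(1 + e^{−2γ})) · (1 + ln N); equivalently, (1 + ln N + K_γ) ≥ (1 + ln N − K_γ) e^{−2γ}. -/
open MeasureTheory in
lemma key_int (a : ℝ) (ha : 0 < a) (δ : ℝ) (h0 : 0 < δ) (h1 : δ ≤ 1) :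
    ∃ J : ℝ, 0 ≤ J ∧
      a * (∫ y in (0:ℝ)..1, (-Real.log y) * (Real.exp (-a * y) - Real.exp (-a * (1 - y)))) = J ∧
      J ≤ a * (1 - Real.exp (-a)) * δ + (1 - Real.exp (-(a/2)))^2 * (-Real.log δ) := by
  set F : ℝ → ℝ := fun y => (1 - Real.exp (-a * y)) * (1 - Real.exp (-a * (1 - y))) with hF
  have hderiv : ∀ y, HasDerivAt F (a * (Real.exp (-a * y) - Real.exp (-a * (1 - y)))) y := by
    intro y
    have e1 : HasDerivAt (fun y : ℝ => Real.exp (-a * y)) (Real.exp (-a * y) * (-a * 1)) y :=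
      ((hasDerivAt_id y).const_mul (-a)).exp
    have e2 : HasDerivAt (fun y : ℝ => Real.exp (-a * (1 - y)))
        (Real.exp (-a * (1 - y)) * (-a * (-1))) y :=
      (((hasDerivAt_id y).const_sub 1).const_mul (-a)).exp
    have := (e1.const_sub 1).mul (e2.const_sub 1)
    refine this.congr_deriv ?_
    ring
  have hF0 : F 0 = 0 := by simp [hF]
  have hF1 : F 1 = 0 := by simp [hF]
  set D : ℝ → ℝ := dslope F 0 with hD
  have hDc : Continuous D := by
    rw [← continuousOn_univ]
    refine (continuousOn_dslope Filter.univ_mem).2 ⟨?_, (hderiv 0).differentiableAt⟩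
    exact fun y _ => (hderiv y).continuousAt.continuousWithinAt
  have hDF : ∀ y, F y = y * D y := by
    intro y
    have := sub_smul_dslope F 0 y
    simp [hF0] at this
    rw [hD, this]
  have hI1 : IntervalIntegrable
      (fun y => (-Real.log y) * (Real.exp (-a * y) - Real.exp (-a * (1 - y)))) volume 0 1 := by
    apply IntervalIntegrable.mul_continuousOn
    · exact intervalIntegral.intervalIntegrable_log'.neg
    · fun_prop
  have hI2 : ∀ c d, IntervalIntegrable D volume c d := fun c d => hDc.intervalIntegrable c d
  have hparts : ∫ y in (0:ℝ)..1,
      (D y - a * ((-Real.log y) * (Real.exp (-a * y) - Real.exp (-a * (1 - y))))) = 0 := by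
    have := intervalIntegral.integral_eq_sub_of_hasDerivAt_of_le (a := 0) (b := 1)
      (f := fun y => D y * (y * Real.log y))
      (f' := fun y => D y - a * ((-Real.log y) * (Real.exp (-a * y) - Real.exp (-a * (1 - y)))))
      zero_le_one (hDc.mul Real.continuous_mul_log).continuousOn ?_
      ((hI2 0 1).sub (hI1.const_mul a))
    · rw [this]; simp
    · intro y hy
      have hy0 : y ≠ 0 := hy.1.ne'
      have e : (fun y => D y * (y * Real.log y)) = fun y => F y * Real.log y := by
        funext z; rw [hDF]; ring
      rw [e]
      refine ((hderiv y).mul (Real.hasDerivAt_log hy0)).congr_deriv ?_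
      rw [hDF]; field_simp; ring
  rw [intervalIntegral.integral_sub (hI2 0 1) (hI1.const_mul a),
    intervalIntegral.integral_const_mul] at hparts
  have hub : ∀ y ∈ Set.Icc (0:ℝ) 1, F y ≤ (a * (1 - Real.exp (-a))) * y := by
    intro y hy
    have b1 : 1 - Real.exp (-a * y) ≤ a * y := by
      have := Real.add_one_le_exp (-a * y); linarith
    have b2 : 1 - Real.exp (-a * (1 - y)) ≤ 1 - Real.exp (-a) := by
      have : Real.exp (-a) ≤ Real.exp (-a * (1 - y)) := by
        apply Real.exp_le_exp.2; nlinarith [hy.1]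
      linarith
    have b3 : 0 ≤ 1 - Real.exp (-a * (1 - y)) := by
      have : Real.exp (-a * (1 - y)) ≤ 1 := by
        apply Real.exp_le_one_iff.2; nlinarith [hy.2]
      linarith
    have b4 : 0 ≤ a * y := mul_nonneg ha.le hy.1
    calc F y ≤ (a * y) * (1 - Real.exp (-a)) := mul_le_mul b1 b2 b3 b4
      _ = _ := by ring
  have hnn : ∀ y ∈ Set.Icc (0:ℝ) 1, 0 ≤ F y := by
    intro y hy
    apply mul_nonneg
    · have : Real.exp (-a * y) ≤ 1 := by
        apply Real.exp_le_one_iff.2; nlinarith [hy.1]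
      linarith
    · have : Real.exp (-a * (1 - y)) ≤ 1 := by
        apply Real.exp_le_one_iff.2; nlinarith [hy.2]
      linarith
  have hub2 : ∀ y, F y ≤ (1 - Real.exp (-(a/2)))^2 := by
    intro y
    have s1 : Real.exp (-a * y) = Real.exp (-a * y / 2) ^ 2 := by
      rw [← Real.exp_nat_mul]; congr 1; push_cast; ring
    have s2 : Real.exp (-a * (1 - y)) = Real.exp (-a * (1 - y) / 2) ^ 2 := by
      rw [← Real.exp_nat_mul]; congr 1; push_cast; ring
    have s3 : Real.exp (-(a/2)) = Real.exp (-a * y / 2) * Real.exp (-a * (1 - y) / 2) := by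
      rw [← Real.exp_add]; congr 1; ring
    simp only [hF]
    rw [s1, s2, s3]
    nlinarith [sq_nonneg (Real.exp (-a * y / 2) - Real.exp (-a * (1 - y) / 2))]
  refine ⟨∫ y in (0:ℝ)..1, D y, ?_, by linarith, ?_⟩
  · rw [intervalIntegral.integral_of_le zero_le_one]
    apply setIntegral_nonneg measurableSet_Ioc
    intro y hy
    have := hnn y ⟨hy.1.le, hy.2⟩
    rw [hDF] at this
    exact nonneg_of_mul_nonneg_right this hy.1
  · rw [← intervalIntegral.integral_add_adjacent_intervals (hI2 0 δ) (hI2 δ 1)]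
    apply add_le_add
    · have : ∫ y in (0:ℝ)..δ, D y ≤ ∫ y in (0:ℝ)..δ, (a * (1 - Real.exp (-a))) := by
        apply intervalIntegral.integral_mono_on_of_le_Ioo h0.le (hI2 0 δ) (by simp)
        intro y hy
        have := hub y ⟨hy.1.le, hy.2.le.trans h1⟩
        rw [hDF, mul_comm] at this
        exact le_of_mul_le_mul_right this hy.1
      refine this.trans (le_of_eq ?_)
      simp; ring
    · have hne : (0:ℝ) ∉ Set.uIcc δ 1 := by
        rw [Set.uIcc_of_le h1]; intro h; exact absurd h.1 (not_le.2 h0)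
      have : ∫ y in δ..1, D y ≤ ∫ y in δ..1, (1 - Real.exp (-(a/2)))^2 * y⁻¹ := by
        apply intervalIntegral.integral_mono_on_of_le_Ioo h1 (hI2 δ 1)
        · refine IntervalIntegrable.const_mul ?_ _
          exact intervalIntegral.intervalIntegrable_inv (fun x hx h => hne (h ▸ hx)) continuousOn_id
        intro y hy
        have hy0 : 0 < y := h0.trans hy.1
        have := hub2 y
        rw [hDF] at this
        rw [← div_eq_mul_inv, le_div_iff₀ hy0]; linarith
      refine this.trans (le_of_eq ?_)
      rw [intervalIntegral.integral_const_mul, integral_inv hne]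
      simp

lemma large_a (a : ℝ) (ha : 8/5 ≤ a) : 1 + Real.exp (-a) ≤ a * (1 - Real.exp (-a)) := by
  have h := Real.sum_le_exp_of_nonneg (show 0 ≤ a by linarith) 4
  simp [Finset.sum_range_succ, Nat.factorial] at h
  have hm : Real.exp a * Real.exp (-a) = 1 := by rw [← Real.exp_add]; simp
  have hp := Real.exp_pos (-a)
  have h2 : a + 1 ≤ (a - 1) * Real.exp a := by
    have : (a - 1) * (1 + a + a^2/2 + a^3/6) ≤ (a - 1) * Real.exp a :=
      mul_le_mul_of_nonneg_left (by linarith) (by linarith)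
    refine le_trans ?_ this
    obtain ⟨t, ht, rfl⟩ : ∃ t, 0 ≤ t ∧ a = 8/5 + t := ⟨a - 8/5, by linarith, by ring⟩
    nlinarith [pow_nonneg ht 2, pow_nonneg ht 3, pow_nonneg ht 4]
  nlinarith [mul_le_mul_of_nonneg_right h2 hp.le]

lemma small_a (a : ℝ) (h0 : 0 < a) (ha : a ≤ 8/5) :
    a/2 * (1 - Real.exp (-a)) * (1 + Real.exp (-a)) ≤
      (1 - Real.exp (-a))^2 + (1 - Real.exp (-(a/2)))^2 * (2 * Real.exp (-(a/2))) * (69/100) := by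
  set r := Real.exp (a/4) with hr
  have hr1 : 1 ≤ r := Real.one_le_exp (by linarith)
  have hr2 : r ≤ 3/2 := by
    have h5 : r ^ 5 ≤ (3/2) ^ 5 := by
      rw [hr, ← Real.exp_nat_mul]
      have : Real.exp ((5:ℕ) * (a/4)) ≤ Real.exp 2 := by
        apply Real.exp_le_exp.2; push_cast; linarith
      have e2 : Real.exp 2 = Real.exp 1 ^ 2 := by rw [← Real.exp_nat_mul]; norm_num
      have := Real.exp_one_lt_d9
      have := Real.exp_pos 1
      nlinarith
    exact le_of_pow_le_pow_left₀ (by norm_num) (by norm_num) h5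
  have hr0 : 0 < r := by linarith
  have e1 : Real.exp (-(a/2)) = 1 / r^2 := by
    rw [hr, ← Real.exp_nat_mul, one_div, ← Real.exp_neg]; congr 1; push_cast; ring
  have e2 : Real.exp (-a) = 1 / r^4 := by
    rw [hr, ← Real.exp_nat_mul, one_div, ← Real.exp_neg]; congr 1; push_cast; ring
  have hs : a / 2 ≤ r - 1 / r := by
    have := Real.self_le_sinh_iff.2 (show 0 ≤ a/4 by linarith)
    rw [Real.sinh_eq, Real.exp_neg, ← hr] at this
    rw [one_div]; linarith
  have hpoly : (1 + r^2) * (1 + r^4) ≤ r * (r^4 + (2 + 2*(69/100)) * r^2 + 1) := by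
    clear_value r
    obtain ⟨t, ht, rfl⟩ : ∃ t, 0 ≤ t ∧ r = 1 + t := ⟨r - 1, by linarith, by ring⟩
    have ht2 : 0 ≤ 1/2 - t := by linarith
    nlinarith [mul_nonneg ht ht2, mul_nonneg (pow_nonneg ht 2) ht2, mul_nonneg (pow_nonneg ht 3) ht2, mul_nonneg (pow_nonneg ht 4) ht2, mul_nonneg (pow_nonneg ht 5) ht2]
  rw [e1, e2]
  have hq : 0 ≤ (1 - 1 / r^4) * (1 + 1 / r^4) := by
    have : 1 / r^4 ≤ 1 := by
      rw [div_le_one (by positivity)]; exact one_le_pow₀ hr1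
    apply mul_nonneg (by linarith); positivity
  have h3 : a/2 * (1 - 1 / r^4) * (1 + 1 / r^4) ≤ (r - 1/r) * ((1 - 1 / r^4) * (1 + 1 / r^4)) := by
    rw [mul_assoc]; exact mul_le_mul_of_nonneg_right hs hq
  refine h3.trans ?_
  rw [← sub_nonneg]
  have : (1 - 1 / r^4)^2 + (1 - 1/r^2)^2 * (2 * (1/r^2)) * (69/100) - (r - 1/r) * ((1 - 1 / r^4) * (1 + 1 / r^4))
     = (r^2-1)^2 / r^9 * (r * (r^4 + (2 + 2*(69/100)) * r^2 + 1) - (1 + r^2) * (1 + r^4)) := by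
    field_simp; ring
  rw [this]
  exact mul_nonneg (by positivity) (by linarith)

/-- For `γ > 0` and `N ≥ 2` with `N ≥ 4γ²`, one has
`K_γ ≤ ((1 − e^{−2γ})/(1 + e^{−2γ}))(1 + ln N)`; equivalently,
`1 + ln N + K_γ ≥ (1 + ln N − K_γ) e^{−2γ}`. -/
theorem Ksel_le_tanh_mul (γ N : ℝ) (hγ : 0 < γ) (hN2 : 2 ≤ N) (hNγ : 4 * γ ^ 2 ≤ N) :
    Ksel γ ≤ (1 - Real.exp (-2 * γ)) / (1 + Real.exp (-2 * γ)) * (1 + Real.log N) ∧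
    (1 + Real.log N - Ksel γ) * Real.exp (-2 * γ) ≤ 1 + Real.log N + Ksel γ := by
  have hN0 : 0 < N := by linarith
  obtain ⟨J, hJ0, hJ, hJu⟩ := key_int (2*γ) (by linarith) (1/N) (by positivity)
    (by rw [div_le_one hN0]; linarith)
  have hL : 69/100 ≤ Real.log N := by
    have := Real.log_le_log (by norm_num) hN2
    have := Real.log_two_gt_d9
    linarith
  set L := Real.log N with hLdef
  have hlog : -Real.log (1/N) = L := by rw [one_div, Real.log_inv, neg_neg]
  rw [hlog] at hJu
  have hE1 : Real.exp (-(2*γ)) < 1 := Real.exp_lt_one_iff.2 (by linarith)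
  have hK : Ksel γ = J / (1 - Real.exp (-(2*γ))) := by
    unfold Ksel omegaSel
    rw [if_neg hγ.ne', ← hJ]
    simp only [neg_mul]
    ring
  have hKn : 0 ≤ Ksel γ := by rw [hK]; exact div_nonneg hJ0 (by linarith)
  have hneg : -2 * γ = -(2*γ) := by ring
  rw [hneg]
  have hEp := Real.exp_pos (-(2*γ))
  constructor
  · rw [hK, div_mul_eq_mul_div, div_le_div_iff₀ (by linarith) (by linarith)]
    have hqE : Real.exp (-(2*γ)) = Real.exp (-(2*γ/2)) ^ 2 := by
      rw [← Real.exp_nat_mul]; congr 1; push_cast; ring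
    have hqp := Real.exp_pos (-(2*γ/2))
    have main : 2*γ * (1/N) * (1 - Real.exp (-(2*γ))) * (1 + Real.exp (-(2*γ))) ≤
        (1 - Real.exp (-(2*γ)))^2 +
          (1 - Real.exp (-(2*γ/2)))^2 * (2 * Real.exp (-(2*γ/2))) * L := by
      rcases le_total (2*γ) (8/5) with h | h
      · have hs := small_a (2*γ) (by linarith) h
        have h1 : 2*γ*(1/N) ≤ 2*γ/2 := by
          rw [mul_one_div]; exact div_le_div_of_nonneg_left (by linarith) (by norm_num) hN2
        have h2 : (1 - Real.exp (-(2*γ/2)))^2 * (2 * Real.exp (-(2*γ/2))) * (69/100) ≤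
            (1 - Real.exp (-(2*γ/2)))^2 * (2 * Real.exp (-(2*γ/2))) * L :=
          mul_le_mul_of_nonneg_left hL (by positivity)
        have h3 : 2*γ * (1/N) * (1 - Real.exp (-(2*γ))) * (1 + Real.exp (-(2*γ))) ≤
            2*γ/2 * (1 - Real.exp (-(2*γ))) * (1 + Real.exp (-(2*γ))) :=
          mul_le_mul_of_nonneg_right (mul_le_mul_of_nonneg_right h1 (by linarith)) (by linarith)
        linarith
      · have hl := large_a (2*γ) h
        have h1 : 2*γ*(1/N) * (2*γ) ≤ 1 := by
          rw [mul_one_div, div_mul_eq_mul_div, div_le_one hN0]; nlinarith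
        have h2 : 2*γ*(1/N) * (1 + Real.exp (-(2*γ))) ≤ 1 - Real.exp (-(2*γ)) := by
          calc _ ≤ 2*γ*(1/N) * (2*γ * (1 - Real.exp (-(2*γ)))) :=
                mul_le_mul_of_nonneg_left hl (by positivity)
            _ = (2*γ*(1/N) * (2*γ)) * (1 - Real.exp (-(2*γ))) := by ring
            _ ≤ 1 * (1 - Real.exp (-(2*γ))) := mul_le_mul_of_nonneg_right h1 (by linarith)
            _ = _ := one_mul _
        have h3 := mul_le_mul_of_nonneg_right h2 (show 0 ≤ 1 - Real.exp (-(2*γ)) by linarith)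
        have h4 : 0 ≤ (1 - Real.exp (-(2*γ/2)))^2 * (2 * Real.exp (-(2*γ/2))) * L :=
          mul_nonneg (by positivity) (by linarith)
        linarith
    have h5 := mul_le_mul_of_nonneg_right hJu (show 0 ≤ 1 + Real.exp (-(2*γ)) by linarith)
    refine h5.trans ?_
    rw [hqE] at main ⊢
    generalize Real.exp (-(2*γ/2)) = q at *
    generalize 1/N = d at *
    linarith
  · nlinarith [mul_nonneg hKn hEp.le]
end
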